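/- arXiv:2104.10101 — 2 statements merged into one kernel-verified Lean document; each statement's English description precedes it below -/
import Mathlib

section
/- Fix D = {d_1 < … < d_k} ⊆ [n−1] with d_0 = 0, d_{k+1} = n and I = [n−1] ∖ D; let c ∈ S_n be a standard Coxeter element of some parabolic subgroup with ℓ(w_0(I)c) = ℓ(w_0(I)) + ℓ(c) and I ⊆ J(w_0(I)c); let λ be a partition with at most n parts and γ ∈ Par_D. Let β ∈ P_{cλ,γ}, let i < j be in the same block, and suppose β_i > β_j − (j−i). Then t_{ij}β ∈ P_{cλ,γ} if and only if: (1) leftmin_{cλ}(i) ≤ β_j − (j−i); (2) rightmax_{cλ}(j) ≥ β_i + (j−i); and (3) if (i,j) is interweaved for cλ, then, with m = center_{cλ}(i,j), β_1 + ⋯ + β_{i−1} + (β_j − (j−i)) + β_{i+1} + ⋯ + β_m ≥ (cλ)_1 + ⋯ + (cλ)_m. -/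
open scoped Classical

namespace LSS

noncomputable section

open MvPolynomial

/-- The simple transposition `s_i ∈ S_n` (`1 ≤ i ≤ n-1`, 1-indexed): it exchanges the
letters `i` and `i+1` of `[n] = {1, …, n}`, realized on `Fin n` (0-indexed) as the swap
of `i-1` and `i`. For `i` out of range it is the identity. -/
def st (n : ℕ) (i : ℕ) : Equiv.Perm (Fin n) :=
  if h : 0 < i ∧ i < n then Equiv.swap ⟨i - 1, by omega⟩ ⟨i, h.2⟩ else 1

/-- Coxeter length of `w ∈ S_n` = number of inversions. -/
def len (n : ℕ) (w : Equiv.Perm (Fin n)) : ℕ :=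
  (Finset.univ.filter fun p : Fin n × Fin n => p.1 < p.2 ∧ w p.2 < w p.1).card

/-- `L` is a reduced word for `w`: a list of indices in `[n-1]` of length `ℓ(w)` whose
associated product of simple transpositions is `w`. -/
def IsRedWord (n : ℕ) (L : List ℕ) (w : Equiv.Perm (Fin n)) : Prop :=
  (∀ i ∈ L, 1 ≤ i ∧ i ≤ n - 1) ∧ (L.map (st n)).prod = w ∧ L.length = len n w

/-- The left descent set `J(w) = {j ∈ [n-1] : ℓ(s_j w) < ℓ(w)}`. -/
def Descents (n : ℕ) (w : Equiv.Perm (Fin n)) : Set ℕ :=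
  {j | 1 ≤ j ∧ j ≤ n - 1 ∧ len n (st n j * w) < len n w}

/-- The parabolic subgroup of `S_n` generated by `{s_i : i ∈ I}`. -/
def parab (n : ℕ) (I : Set ℕ) : Subgroup (Equiv.Perm (Fin n)) :=
  Subgroup.closure (st n '' I)

/-- `u = w_0(I)`, the longest element of the parabolic subgroup generated by `{s_i : i ∈ I}`. -/
def IsLongest (n : ℕ) (I : Set ℕ) (u : Equiv.Perm (Fin n)) : Prop :=
  u ∈ parab n I ∧ ∀ v ∈ parab n I, len n v ≤ len n u

/-- `c` is a standard Coxeter element of some parabolic subgroup of `S_n`: a product of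
the elements of some subset of `{s_1, …, s_{n-1}}`, each appearing exactly once, in some order. -/
def IsStdCox (n : ℕ) (c : Equiv.Perm (Fin n)) : Prop :=
  ∃ L : List ℕ, L.Nodup ∧ (∀ i ∈ L, 1 ≤ i ∧ i ≤ n - 1) ∧ (L.map (st n)).prod = c

/-- A weak composition `β : Fin n → ℕ` as an exponent vector. -/
def expOf (n : ℕ) (β : Fin n → ℕ) : Fin n →₀ ℕ := Finsupp.equivFunOnFinite.symm β

/-- The monomial `x^β = x_1^{β_1} ⋯ x_n^{β_n}`. -/
def mono (n : ℕ) (β : Fin n → ℕ) : MvPolynomial (Fin n) ℤ := monomial (expOf n β) 1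

/-- The coefficient `[x^β] f`. -/
def coeffOf (n : ℕ) (β : Fin n → ℕ) (f : MvPolynomial (Fin n) ℤ) : ℤ := coeff (expOf n β) f

/-- The isobaric divided difference (Demazure) operator
`π_i(f) = (x_i f − x_{i+1} s_i f)/(x_i − x_{i+1})` (1-indexed `i`), defined as the unique
polynomial `g` with `(x_i − x_{i+1})·g = x_i f − x_{i+1} s_i f`; such a `g` always exists
and is unique since `ℤ[x_1,…,x_n]` is a domain. -/
def dem (n : ℕ) (i : ℕ) (f : MvPolynomial (Fin n) ℤ) : MvPolynomial (Fin n) ℤ :=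
  if h : 0 < i ∧ i < n then
    if hg : ∃ g, (X (⟨i - 1, by omega⟩ : Fin n) - X (⟨i, h.2⟩ : Fin n)) * g =
        X (⟨i - 1, by omega⟩ : Fin n) * f -
          X (⟨i, h.2⟩ : Fin n) *
            rename (⇑(Equiv.swap (⟨i - 1, by omega⟩ : Fin n) (⟨i, h.2⟩ : Fin n))) f then
      hg.choose
    else 0
  else f

/-- `π_{i_1} π_{i_2} ⋯ π_{i_ℓ} (f)` for a word `L = [i_1, …, i_ℓ]`. -/
def demWord (n : ℕ) (L : List ℕ) (f : MvPolynomial (Fin n) ℤ) : MvPolynomial (Fin n) ℤ :=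
  L.foldr (dem n) f

/-- Entry accessor for a composition, 0-indexed position, default `0` out of range. -/
def ent (n : ℕ) (α : Fin n → ℕ) (p : ℕ) : ℕ := if h : p < n then α ⟨p, h⟩ else 0

/-- Exchange the entries of `α` in (0-indexed) positions `p` and `p+1`. -/
def swapAt (n : ℕ) (p : ℕ) (α : Fin n → ℕ) : Fin n → ℕ := fun m =>
  if (m : ℕ) = p then ent n α (p + 1) else if (m : ℕ) = p + 1 then ent n α p else α m

/-- Auxiliary fuelled recursion computing the key polynomial `κ_α`:
if `α` is weakly decreasing, `κ_α = x^α`; otherwise, choosing an ascent `α_p < α_{p+1}`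
(0-indexed `p`), `κ_α = π_{p+1}(κ_{α̂})` where `α̂` swaps the two entries.  The fuel
`n*n` in `keyPoly` strictly exceeds the number of co-inversions, which drops by one at
each step, so the recursion always terminates at a weakly decreasing composition. -/
def keyAux (n : ℕ) : ℕ → (Fin n → ℕ) → MvPolynomial (Fin n) ℤ
  | 0, α => mono n α
  | k + 1, α =>
    if h : ∃ p : Fin n, ent n α p.1 < ent n α (p.1 + 1) then
      dem n (h.choose.1 + 1) (keyAux n k (swapAt n h.choose.1 α))
    else mono n α

/-- The key polynomial `κ_α`. -/
def keyPoly (n : ℕ) (α : Fin n → ℕ) : MvPolynomial (Fin n) ℤ := keyAux n (n * n) α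

/-- `wλ`, the composition `(λ_{w⁻¹(1)}, …, λ_{w⁻¹(n)})`. -/
def pact (n : ℕ) (w : Equiv.Perm (Fin n)) (lam : Fin n → ℕ) : Fin n → ℕ :=
  fun i => lam (w⁻¹ i)

/-- `lam` is a partition (weakly decreasing vector) with at most `n` parts. -/
def IsPartition (n : ℕ) (lam : Fin n → ℕ) : Prop := ∀ i j : Fin n, i ≤ j → lam j ≤ lam i

/-- Box `(c, r)` (column, row; both 1-indexed) belongs to the skyline diagram `D(α)`. -/
def InDiag (n : ℕ) (α : Fin n → ℕ) (c r : ℕ) : Prop :=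
  1 ≤ c ∧ c ≤ n ∧ 1 ≤ r ∧ r ≤ ent n α (c - 1)

/-- `F` (value of box (column, row)) is a filling of `D(α)` that is flagged (labels in
column `c` are in `{1, …, c}`) and row distinct. -/
def IsTab (n : ℕ) (α : Fin n → ℕ) (F : ℕ → ℕ → ℕ) : Prop :=
  (∀ c r, InDiag n α c r → 1 ≤ F c r ∧ F c r ≤ c) ∧
  ∀ c c' r, InDiag n α c r → InDiag n α c' r → c ≠ c' → F c r ≠ F c' r

/-- The weight of a filling: `wt(F)_i` = number of occurrences of the label `i`
(1-indexed; `Fin` position `i` records the label `i+1`). -/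
def wt (n : ℕ) (α : Fin n → ℕ) (F : ℕ → ℕ → ℕ) : Fin n → ℕ := fun i =>
  ((Finset.Icc 1 n ×ˢ Finset.Icc 1 (Finset.univ.sup α)).filter fun p =>
    InDiag n α p.1 p.2 ∧ F p.1 p.2 = i.1 + 1).card

/-- `leftmin_α(i) = min{α_j : j ≤ i}`. -/
def leftmin (n : ℕ) (α : Fin n → ℕ) (i : Fin n) : ℕ := sInf (α '' {j | j ≤ i})

/-- `rightmax_α(i) = max{α_j : j ≥ i}`. -/
def rightmax (n : ℕ) (α : Fin n → ℕ) (i : Fin n) : ℕ :=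
  Finset.sup (Finset.univ.filter fun j => i ≤ j) α

/-- `d` records `0 = d_0 < d_1 < ⋯ < d_k < d_{k+1} = n`. -/
def BlockData (n k : ℕ) (d : Fin (k + 2) → ℕ) : Prop :=
  d 0 = 0 ∧ d (Fin.last (k + 1)) = n ∧ StrictMono d

/-- `D = {d_1, …, d_k}` as a set of natural numbers. -/
def Dset (k : ℕ) (d : Fin (k + 2) → ℕ) : Set ℕ :=
  {m | ∃ t : Fin (k + 2), t ≠ 0 ∧ t ≠ Fin.last (k + 1) ∧ d t = m}

/-- `I = [n−1] ∖ D`. -/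
def Iset (n k : ℕ) (d : Fin (k + 2) → ℕ) : Set ℕ :=
  {m | 1 ≤ m ∧ m ≤ n - 1 ∧ m ∉ Dset k d}

/-- Positions `i, j` (of `Fin n`, 0-indexed; 1-indexed letters `i+1, j+1`) lie in the same
block: some `t` has `d_t < i+1, j+1 ≤ d_{t+1}`. -/
def SameBlock (n k : ℕ) (d : Fin (k + 2) → ℕ) (i j : Fin n) : Prop :=
  ∃ t : Fin (k + 1), d t.castSucc ≤ i.1 ∧ i.1 < d t.succ ∧ d t.castSucc ≤ j.1 ∧ j.1 < d t.succ

/-- The variables `X_t = {x_{d_t + 1}, …, x_{d_{t+1}}}` of the `t`-th block. -/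
def blockVars (n k : ℕ) (d : Fin (k + 2) → ℕ) (t : Fin (k + 1)) : Finset (Fin n) :=
  Finset.univ.filter fun p => d t.castSucc ≤ p.1 ∧ p.1 < d t.succ

/-- Complete homogeneous symmetric polynomial of degree `m` in the variables `S`. -/
def hPoly (n : ℕ) (S : Finset (Fin n)) (m : ℕ) : MvPolynomial (Fin n) ℤ :=
  ∑ f ∈ S.sym m, ((f : Multiset (Fin n)).map X).prod

/-- `h_z` for `z : ℤ`, with `h_z = 0` for `z < 0`. -/
def hZ (n : ℕ) (S : Finset (Fin n)) (z : ℤ) : MvPolynomial (Fin n) ℤ :=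
  if 0 ≤ z then hPoly n S z.toNat else 0

/-- The Schur polynomial `s_lam` in the variable set `S`, for a partition `lam`
(1-indexed parts, at most `t` of them), via the Jacobi–Trudi determinant
`det(h_{lam_i − i + j})_{1 ≤ i,j ≤ t}`. -/
def schurP (n : ℕ) (S : Finset (Fin n)) (t : ℕ) (lam : ℕ → ℕ) : MvPolynomial (Fin n) ℤ :=
  (Matrix.of fun i j : Fin t =>
    hZ n S ((lam (i.1 + 1) : ℤ) - (i.1 + 1) + (j.1 + 1))).det

/-- `γ ∈ Par_D`: a `(k+1)`-tuple of partitions, the `t`-th having at most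
`d_{t+1} − d_t` nonzero parts (1-indexed parts; the unused index `0` is normalized to `0`). -/
def ParD (k : ℕ) (d : Fin (k + 2) → ℕ) (γ : Fin (k + 1) → ℕ → ℕ) : Prop :=
  ∀ t : Fin (k + 1), γ t 0 = 0 ∧ (∀ a b : ℕ, 1 ≤ a → a ≤ b → γ t b ≤ γ t a) ∧
    ∀ m : ℕ, d t.succ - d t.castSucc < m → γ t m = 0

/-- The `D`-Schur polynomial `s_{γ^1,…,γ^{k+1}} = ∏_t s_{γ^t}(X_t)`. -/
def dSchur (n k : ℕ) (d : Fin (k + 2) → ℕ) (γ : Fin (k + 1) → ℕ → ℕ) :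
    MvPolynomial (Fin n) ℤ :=
  ∏ t : Fin (k + 1), schurP n (blockVars n k d t) (d t.succ - d t.castSucc) (γ t)

/-- Truncation of an integer vector to a natural-number vector. -/
def toNatV (n : ℕ) (β : Fin n → ℤ) : Fin n → ℕ := fun i => (β i).toNat

/-- `j − i` as an integer. -/
def gapZ (n : ℕ) (i j : Fin n) : ℤ := (j.1 : ℤ) - (i.1 : ℤ)

/-- The move `t_{ij}`: replace `β_i` by `β_j − (j−i)` and `β_j` by `β_i + (j−i)`. -/
def tmv (n : ℕ) (i j : Fin n) (β : Fin n → ℤ) : Fin n → ℤ := fun m =>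
  if m = i then β j - gapZ n i j else if m = j then β i + gapZ n i j else β m

/-- The rank `θ(β) = #{(a,b) : a < b in the same block and β_a < β_b − (b−a)}`. -/
def theta (n k : ℕ) (d : Fin (k + 2) → ℕ) (β : Fin n → ℤ) : ℕ :=
  (Finset.univ.filter fun p : Fin n × Fin n =>
    p.1 < p.2 ∧ SameBlock n k d p.1 p.2 ∧ β p.1 < β p.2 - gapZ n p.1 p.2).card

/-- One step up in the Bruhat-type order: `β ⋖ t_{ij} β` whenever `i < j` are in the same
block and `β_i > β_j − (j−i)`. -/
def stepUp (n k : ℕ) (d : Fin (k + 2) → ℕ) (β β' : Fin n → ℤ) : Prop :=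
  ∃ i j : Fin n, i < j ∧ SameBlock n k d i j ∧ β j - gapZ n i j < β i ∧ β' = tmv n i j β

/-- The order on compositions: transitive (reflexive) closure of `stepUp`. -/
def leB (n k : ℕ) (d : Fin (k + 2) → ℕ) : (Fin n → ℤ) → (Fin n → ℤ) → Prop :=
  Relation.ReflTransGen (stepUp n k d)

/-- Membership in the poset `P_{α,γ}` (for `α = cλ`): `β` is a weak composition with
`[x^β] κ_α ≠ 0` and `π_{w_0(I)}(x^β) = ± s_γ`. -/
def memP (n k : ℕ) (d : Fin (k + 2) → ℕ) (w0I : Equiv.Perm (Fin n)) (α : Fin n → ℕ)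
    (γ : Fin (k + 1) → ℕ → ℕ) (β : Fin n → ℤ) : Prop :=
  (∀ i, 0 ≤ β i) ∧ coeffOf n (toNatV n β) (keyPoly n α) ≠ 0 ∧
  ∃ L, IsRedWord n L w0I ∧
    (demWord n L (mono n (toNatV n β)) = dSchur n k d γ ∨
     demWord n L (mono n (toNatV n β)) = -dSchur n k d γ)

/-- The pair `i < j` is interweaved for `α`: `α_m ≥ α_{m+1}` for `i ≤ m < j`,
`leftmin_α(i) < α_i` and `rightmax_α(j) > α_j`. -/
def Interweaved (n : ℕ) (α : Fin n → ℕ) (i j : Fin n) : Prop :=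
  i < j ∧ (∀ p : Fin n, i ≤ p → p < j → ent n α (p.1 + 1) ≤ α p) ∧
  leftmin n α i < α i ∧ α j < rightmax n α j

/-- `center_α(i,j) = max{m : i ≤ m ≤ j and α_m ≥ rightmax_α(j)}` (as a 0-indexed position). -/
def center (n : ℕ) (α : Fin n → ℕ) (i j : Fin n) : ℕ :=
  Finset.sup (Finset.univ.filter fun p : Fin n => i ≤ p ∧ p ≤ j ∧ rightmax n α j ≤ α p)
    fun p => p.1

/-- Partial sum `β_1 + ⋯ + β_{m+1}` (0-indexed positions `≤ m`) of an integer vector. -/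
def psumZ (n : ℕ) (β : Fin n → ℤ) (m : ℕ) : ℤ :=
  ∑ p ∈ Finset.univ.filter (fun p : Fin n => p.1 ≤ m), β p

/-- Partial sum of a composition, as an integer. -/
def psumN (n : ℕ) (α : Fin n → ℕ) (m : ℕ) : ℤ :=
  ∑ p ∈ Finset.univ.filter (fun p : Fin n => p.1 ≤ m), (α p : ℤ)

/-- Composition pattern containment. -/
def ContainsPat (n : ℕ) {m : ℕ} (α : Fin n → ℕ) (pat : Fin m → ℕ) : Prop :=
  ∃ g : Fin m → Fin n, StrictMono g ∧
    (∀ s t : Fin m, pat s ≤ pat t ↔ α (g s) ≤ α (g t)) ∧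
    ∀ s t : Fin m, |(pat s : ℤ) - (pat t : ℤ)| ≤ |(α (g s) : ℤ) - (α (g t) : ℤ)|

end

end LSS

namespace LSS

/-- Flow inequalities describing the support. -/
def InS (M : Finset ℕ) (τ : ℕ → ℕ) (l y : ℕ → ℤ) : Prop :=
  (∀ m, m ∉ M → y m = 0) ∧ ∀ p, p + 1 ∈ M → 0 ≤ y (p + 1) ∧
    y (p + 1) ≤ l p - l (p + 1) + (if τ p < τ (p + 1) then y p else 0)
      + (if τ (p + 2) < τ (p + 1) then y (p + 2) else 0)

/-- The extremal flow. -/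
def GoodY (M : Finset ℕ) (τ : ℕ → ℕ) (l y : ℕ → ℤ) : Prop :=
  (∀ m, m ∉ M → y m = 0) ∧ ∀ p, p + 1 ∈ M →
    y (p + 1) = l p - l (p + 1) + (if τ p < τ (p + 1) then y p else 0)
      + (if τ (p + 2) < τ (p + 1) then y (p + 2) else 0)

section arith
variable {M : Finset ℕ} {τ : ℕ → ℕ} {l Y y : ℕ → ℤ}

theorem GoodY.nonneg (hl : Antitone l) (h0 : 0 ∉ M) (hY : GoodY M τ l Y) : ∀ m, 0 ≤ Y m := by
  have key : ∀ t m, τ m < t → 0 ≤ Y m := by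
    intro t
    induction t with
    | zero => intro m h; omega
    | succ t ih =>
      intro m hm
      by_cases hM : m ∈ M
      · obtain ⟨p, rfl⟩ : ∃ p, m = p + 1 := ⟨m - 1, by
          rcases m with _ | m
          · exact absurd hM h0
          · rfl⟩
        rw [hY.2 p hM]
        have h1 := hl (Nat.le_succ p)
        have h2 : 0 ≤ (if τ p < τ (p + 1) then Y p else 0) := by
          split_ifs with h
          · exact ih _ (by omega)
          · rfl
        have h3 : 0 ≤ (if τ (p+2) < τ (p + 1) then Y (p+2) else 0) := by
          split_ifs with h
          · exact ih _ (by omega)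
          · rfl
        simp only [Nat.succ_eq_add_one] at h1
        linarith
      · rw [hY.1 m hM]
  exact fun m => key _ m (Nat.lt_succ_self _)

theorem InS.nonneg (h0 : 0 ∉ M) (hy : InS M τ l y) : ∀ m, 0 ≤ y m := by
  intro m
  by_cases hM : m ∈ M
  · rcases m with _ | p
    · exact absurd hM h0
    · exact (hy.2 p hM).1
  · rw [hy.1 m hM]

theorem InS.le (h0 : 0 ∉ M) (hY : GoodY M τ l Y) (hy : InS M τ l y) : ∀ m, y m ≤ Y m := by
  have key : ∀ t m, τ m < t → y m ≤ Y m := by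
    intro t
    induction t with
    | zero => intro m h; omega
    | succ t ih =>
      intro m hm
      by_cases hM : m ∈ M
      · rcases m with _ | p
        · exact absurd hM h0
        rw [hY.2 p hM]
        refine (hy.2 p hM).2.trans ?_
        gcongr
        · split_ifs with h
          · exact ih _ (by omega)
          · rfl
        · split_ifs with h
          · exact ih _ (by omega)
          · rfl
      · rw [hY.1 m hM, hy.1 m hM]
  exact fun m => key _ m (Nat.lt_succ_self _)

theorem GoodY.inS (hl : Antitone l) (h0 : 0 ∉ M) (hY : GoodY M τ l Y) : InS M τ l Y :=
  ⟨hY.1, fun p hp => ⟨hY.nonneg hl h0 _, (hY.2 p hp).le⟩⟩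

/-- value below -/
def VV (τ : ℕ → ℕ) (l Y : ℕ → ℤ) (p : ℕ) : ℤ :=
  l (p + 1) - (if τ (p + 2) < τ (p + 1) then Y (p + 2) else 0)
/-- value above -/
def UU (τ : ℕ → ℕ) (l Y : ℕ → ℤ) (p : ℕ) : ℤ :=
  l p + (if τ p < τ (p + 1) then Y p else 0)

theorem VV_le (hl : Antitone l) (h0 : 0 ∉ M) (hY : GoodY M τ l Y) (p : ℕ) :
    VV τ l Y p ≤ l (p + 1) := by
  have := hY.nonneg hl h0 (p + 2)
  unfold VV; split_ifs <;> linarith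

theorem le_UU (hl : Antitone l) (h0 : 0 ∉ M) (hY : GoodY M τ l Y) (p : ℕ) :
    l p ≤ UU τ l Y p := by
  have := hY.nonneg hl h0 p
  unfold UU; split_ifs <;> linarith

theorem VV_step (hY : GoodY M τ l Y) (r : ℕ) (h : τ (r + 2) < τ (r + 1)) (hr2 : r + 2 ∈ M) :
    VV τ l Y r = VV τ l Y (r + 1) := by
  have := hY.2 (r + 1) hr2
  have h' : ¬ τ (r + 1) < τ (r + 1 + 1) := by simp only [add_assoc]; norm_num; omega
  rw [if_neg h'] at this
  unfold VV
  rw [if_pos h]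
  simp only [add_assoc] at *
  norm_num at *
  linarith

theorem UU_step (hY : GoodY M τ l Y) (r : ℕ) (h : τ (r + 1) < τ (r + 2)) (hr1 : r + 1 ∈ M) :
    UU τ l Y (r + 1) = UU τ l Y r := by
  have := hY.2 r hr1
  have h' : ¬ τ (r + 2) < τ (r + 1) := by omega
  rw [if_neg h'] at this
  unfold UU
  rw [if_pos h]
  linarith

theorem low (hl : Antitone l) (h0 : 0 ∉ M) (hY : GoodY M τ l Y) (hy : InS M τ l y) (p : ℕ)
    (hp : p + 1 ∈ M) : VV τ l Y p ≤ l p + y p - y (p + 1) := by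
  have h1 := (hy.2 p hp).2
  have h2 := hy.le h0 hY (p + 2)
  have h3 := hy.nonneg h0 p
  unfold VV
  split_ifs at * <;> linarith

theorem high (hl : Antitone l) (h0 : 0 ∉ M) (hY : GoodY M τ l Y) (hy : InS M τ l y) (p : ℕ)
    (hp : p + 1 ∈ M) : l (p+1) + y (p+1) - y (p + 2) ≤ UU τ l Y p := by
  have h1 := (hy.2 p hp).2
  have h2 := hy.le h0 hY p
  have h3 := hy.nonneg h0 (p+2)
  unfold UU
  split_ifs at * <;> linarith

theorem VV_mono (hl : Antitone l) (h0 : 0 ∉ M) (hY : GoodY M τ l Y) (p : ℕ) :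
    ∀ d r, r + d = p → VV τ l Y p ≤ VV τ l Y r := by
  intro d
  induction d with
  | zero => intro r h; simp at h; rw [h]
  | succ d ih =>
    intro r h
    by_cases h2 : τ (r + 2) < τ (r + 1) ∧ r + 2 ∈ M
    · rw [VV_step hY r h2.1 h2.2]; exact ih _ (by omega)
    · have : VV τ l Y r = l (r + 1) := by
        unfold VV
        by_cases h3 : r + 2 ∈ M
        · rw [if_neg (by tauto)]; ring
        · rw [hY.1 _ h3]; simp
      rw [this]
      exact (VV_le hl h0 hY p).trans (hl (by omega))

theorem UU_mono (hl : Antitone l) (h0 : 0 ∉ M) (hY : GoodY M τ l Y) (p : ℕ) :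
    ∀ d, UU τ l Y (p + d) ≤ UU τ l Y p := by
  intro d
  induction d with
  | zero => rfl
  | succ d ih =>
    by_cases h2 : τ (p + d + 1) < τ (p + d + 2) ∧ p + d + 1 ∈ M
    · rw [← add_assoc, UU_step hY _ h2.1 h2.2]; exact ih
    · have : UU τ l Y (p + (d + 1)) = l (p + (d + 1)) := by
        unfold UU
        by_cases h3 : p + d + 1 ∈ M
        · rw [if_neg (by simp only [← add_assoc]; tauto)]; ring
        · rw [← add_assoc, hY.1 _ h3]; simp
      rw [this]
      exact (hl (by omega)).trans (le_UU hl h0 hY p)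

theorem low_bound_pre (hl : Antitone l) (h0 : 0 ∉ M) (hY : GoodY M τ l Y) (hy : InS M τ l y) (p : ℕ)
    (r : ℕ) (hr : r ≤ p) (hp : p + 1 ∈ M) : VV τ l Y p ≤ l r + y r - y (r + 1) := by
  by_cases h : r + 1 ∈ M
  · exact (VV_mono hl h0 hY p (p - r) r (by omega)).trans (low hl h0 hY hy r h)
  · rw [hy.1 _ h]
    have := hy.nonneg h0 r
    have h1 := VV_le hl h0 hY p
    have h2 : l (p+1) ≤ l r := hl (by omega)
    linarith

theorem suffix_high (hl : Antitone l) (h0 : 0 ∉ M) (hY : GoodY M τ l Y) (hy : InS M τ l y) (p : ℕ)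
    (r : ℕ) (hr : p + 1 ≤ r) (hp : p + 1 ∈ M) : l r + y r - y (r + 1) ≤ UU τ l Y p := by
  by_cases h : r ∈ M
  · obtain ⟨s, rfl⟩ : ∃ s, r = s + 1 := ⟨r - 1, by omega⟩
    refine (high hl h0 hY hy s h).trans ?_
    have := UU_mono hl h0 hY p (s - p)
    rwa [show p + (s - p) = s by omega] at this
  · rw [hy.1 _ h]
    have := hy.nonneg h0 (r + 1)
    have h1 := le_UU hl h0 hY p
    have h2 : l r ≤ l p := hl (by omega)
    linarith

theorem low_bound_pre' (h0 : 0 ∉ M) (hl : Antitone l) (hy : InS M τ l y)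
    (hY : GoodY M τ l Y) (p : ℕ) (r : ℕ) (hr : r ≤ p) (hp : p + 1 ∉ M) :
    l p ≤ l r + y r - y (r + 1) := by
  by_cases h : r + 1 ∈ M
  · obtain hlt : r < p := by
      rcases hr.lt_or_eq with h1 | h1
      · exact h1
      · subst h1; exact absurd h hp
    clear hr
    have : ∀ d s, s + d + 1 = p → l p ≤ VV τ l Y s := by
      intro d
      induction d with
      | zero =>
        intro s hs
        unfold VV
        have : s + 2 ∉ M := by rw [← hs] at hp; exact hp
        rw [hY.1 _ this]; simp [← hs]
      | succ d ih =>
        intro s hs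
        by_cases h2 : τ (s + 2) < τ (s + 1) ∧ s + 2 ∈ M
        · rw [VV_step hY s h2.1 h2.2]; exact ih _ (by omega)
        · have : VV τ l Y s = l (s + 1) := by
            unfold VV
            by_cases h3 : s + 2 ∈ M
            · rw [if_neg (by tauto)]; ring
            · rw [hY.1 _ h3]; simp
          rw [this]
          exact hl (by omega)
    exact (this (p - r - 1) r (by omega)).trans (low hl h0 hY hy r h)
  · rw [hy.1 _ h]
    have := hy.nonneg h0 r
    have h2 : l p ≤ l r := hl (by omega)
    linarith

theorem suffix_high' (h0 : 0 ∉ M) (hl : Antitone l) (hy : InS M τ l y)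
    (hY : GoodY M τ l Y) (p : ℕ) (r : ℕ) (hr : p + 1 ≤ r) (hp : p + 1 ∉ M) :
    l r + y r - y (r + 1) ≤ l (p + 1) := by
  by_cases h : r ∈ M
  · have hlt : p + 1 < r := by
      rcases hr.lt_or_eq with h1 | h1
      · exact h1
      · subst h1; exact absurd h hp
    have : ∀ d, UU τ l Y (p + 1 + d) ≤ l (p + 1) := by
      intro d
      induction d with
      | zero =>
        unfold UU
        rw [add_zero, hY.1 _ hp]; simp
      | succ d ih =>
        by_cases h2 : τ (p + 1 + d + 1) < τ (p + 1 + d + 2) ∧ p + 1 + d + 1 ∈ M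
        · rw [← add_assoc (p + 1) d 1, UU_step hY _ h2.1 h2.2]; exact ih
        · have : UU τ l Y (p + 1 + (d + 1)) = l (p + 1 + (d + 1)) := by
            unfold UU
            by_cases h3 : p + 1 + d + 1 ∈ M
            · rw [if_neg (by simp only [← add_assoc]; tauto)]; ring
            · rw [← add_assoc (p + 1) d 1, hY.1 _ h3]; simp
          rw [this]
          exact hl (by omega)
    obtain ⟨s, rfl⟩ : ∃ s, r = s + 1 := ⟨r - 1, by omega⟩
    refine (high hl h0 hY hy s h).trans ?_
    have := this (s - (p+1))
    rwa [show p + 1 + (s - (p+1)) = s by omega] at this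
  · rw [hy.1 _ h]
    have := hy.nonneg h0 (r + 1)
    have h2 : l r ≤ l (p+1) := hl (by omega)
    linarith

theorem exist_low (h0 : 0 ∉ M) (hτ : ∀ p, p ∈ M → p + 1 ∈ M → τ p ≠ τ (p + 1))
    (hY : GoodY M τ l Y) (p : ℕ)
    (hp : p + 1 ∈ M) : ∃ r ≤ p, l r + Y r - Y (r + 1) = VV τ l Y p := by
  induction p with
  | zero =>
    refine ⟨0, le_rfl, ?_⟩
    have := hY.2 0 hp
    rw [hY.1 0 h0] at this ⊢
    unfold VV
    simp at *
    linarith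
  | succ p ih =>
    by_cases h : p + 1 ∈ M ∧ τ (p + 2) < τ (p + 1)
    · obtain ⟨r, hr, h2⟩ := ih h.1
      exact ⟨r, by omega, by rw [h2, VV_step hY p h.2 hp]⟩
    · refine ⟨p + 1, le_rfl, ?_⟩
      have := hY.2 (p + 1) hp
      unfold VV
      have h3 : (if τ (p + 1) < τ (p + 1 + 1) then Y (p + 1) else 0) = Y (p + 1) := by
        by_cases h4 : p + 1 ∈ M
        · have h5 : τ (p + 1) ≠ τ (p + 2) := hτ _ h4 hp
          have h6 : ¬ τ (p + 2) < τ (p + 1) := by tauto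
          have h7 : τ (p + 1) < τ (p + 1 + 1) := by show τ (p + 1) < τ (p + 2); omega
          rw [if_pos h7]
        · rw [hY.1 _ h4]; simp
      rw [h3] at this
      linarith

theorem exist_high (B : ℕ) (hB : ∀ m ∈ M, m < B)
    (hτ : ∀ p, p ∈ M → p + 1 ∈ M → τ p ≠ τ (p + 1))
    (hY : GoodY M τ l Y) : ∀ d p, p + d = B → 
    p + 1 ∈ M → ∃ r, p + 1 ≤ r ∧ l r + Y r - Y (r + 1) = UU τ l Y p := by
  intro d
  induction d with
  | zero => intro p h hp; have := hB _ hp; omega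
  | succ d ih =>
    intro p hd hp
    by_cases h : p + 2 ∈ M ∧ τ (p + 1) < τ (p + 2)
    · obtain ⟨r, hr, h2⟩ := ih (p + 1) (by omega) h.1
      exact ⟨r, by omega, by rw [h2, UU_step hY p h.2 hp]⟩
    · refine ⟨p + 1, le_rfl, ?_⟩
      have := hY.2 p hp
      unfold UU
      have h3 : (if τ (p + 2) < τ (p + 1) then Y (p + 2) else 0) = Y (p + 2) := by
        by_cases h4 : p + 2 ∈ M
        · have h5 : τ (p + 1) ≠ τ (p + 2) := hτ _ hp h4
          have h6 : ¬ τ (p + 1) < τ (p + 2) := by tauto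
          rw [if_pos (by omega)]
        · rw [hY.1 _ h4]; simp
      rw [h3] at this
      rw [show p + 1 + 1 = p + 2 by rfl]
      linarith

theorem exist_high' (hτ : ∀ p, p ∈ M → p + 1 ∈ M → τ p ≠ τ (p + 1))
    (hY : GoodY M τ l Y) (p : ℕ) (hp : p + 1 ∈ M) :
    ∃ r, p + 1 ≤ r ∧ l r + Y r - Y (r + 1) = UU τ l Y p :=
  exist_high (p + (M.sup id + 1)) (fun m hm => by
    have : id m ≤ M.sup id := Finset.le_sup hm
    simp at this; omega) hτ hY _ p rfl hp

/-- every entry is at least the left minimum -/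
theorem left_bound (hl : Antitone l) (h0 : 0 ∉ M)
    (hτ : ∀ p, p ∈ M → p + 1 ∈ M → τ p ≠ τ (p + 1))
    (hY : GoodY M τ l Y) (hy : InS M τ l y) (i : ℕ) :
    ∃ r ≤ i, l r + Y r - Y (r + 1) ≤ l i + y i - y (i + 1) := by
  by_cases h : i + 1 ∈ M
  · obtain ⟨r, hr, h1⟩ := exist_low h0 hτ hY i h
    exact ⟨r, hr, h1.le.trans (low hl h0 hY hy i h)⟩
  · by_cases h2 : i ∈ M
    · obtain ⟨s, rfl⟩ : ∃ s, i = s + 1 := ⟨i - 1, by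
        rcases i with _ | i
        · exact absurd h2 h0
        · rfl⟩
      obtain ⟨r, hr, h1⟩ := exist_low h0 hτ hY s h2
      refine ⟨r, by omega, ?_⟩
      rw [h1, hy.1 _ h]
      have := VV_le hl h0 hY s
      have := hy.nonneg h0 (s + 1)
      linarith
    · exact ⟨i, le_rfl, by rw [hY.1 _ h, hY.1 _ h2, hy.1 _ h, hy.1 _ h2]⟩

theorem right_bound (hl : Antitone l) (h0 : 0 ∉ M)
    (hτ : ∀ p, p ∈ M → p + 1 ∈ M → τ p ≠ τ (p + 1))
    (hY : GoodY M τ l Y) (hy : InS M τ l y) (j : ℕ) :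
    ∃ r, j ≤ r ∧ l j + y j - y (j + 1) ≤ l r + Y r - Y (r + 1) := by
  by_cases h : j ∈ M
  · obtain ⟨s, rfl⟩ : ∃ s, j = s + 1 := ⟨j - 1, by
        rcases j with _ | i
        · exact absurd h h0
        · rfl⟩
    obtain ⟨r, hr, h1⟩ := exist_high' hτ hY s h
    exact ⟨r, hr, (high hl h0 hY hy s h).trans h1.ge⟩
  · by_cases h2 : j + 1 ∈ M
    · obtain ⟨r, hr, h1⟩ := exist_high' hτ hY j h2
      refine ⟨r, by omega, ?_⟩
      rw [h1, hy.1 _ h]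
      have := le_UU hl h0 hY j
      have := hy.nonneg h0 (j + 1)
      linarith
    · exact ⟨j, le_rfl, by rw [hY.1 _ h, hY.1 _ h2, hy.1 _ h, hy.1 _ h2]⟩

end arith
end LSS

namespace LSS
section arith
variable {M : Finset ℕ} {τ : ℕ → ℕ} {l Y y : ℕ → ℤ}

theorem exists_source (hτ : ∀ p, p ∈ M → p + 1 ∈ M → τ p ≠ τ (p + 1)) (i j : ℕ) (hij : i < j)
    (hM : ∀ p, i ≤ p → p < j → p + 1 ∈ M)
    (hb : ∀ p, i ≤ p → p < j → p + 1 ∈ M →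
      (p + 2 ∈ M ∧ τ (p + 1) < τ (p + 2)) ∨ (p ∈ M ∧ τ (p + 1) < τ p)) :
    ∃ q, i ≤ q ∧ q < j ∧
      (∀ p, q ≤ p → p + 1 < j → τ (p + 1) < τ (p + 2)) ∧
      (∀ p, i < p → p ≤ q → τ (p + 1) < τ p) ∧
      (q + 1 < j → j + 1 ∈ M ∧ τ j < τ (j + 1)) ∧
      (i < q → i ∈ M ∧ τ (i + 1) < τ i) := by
  obtain ⟨q, hq, hmin⟩ := Finset.exists_min_image (Finset.Ico i j) (fun p => τ (p + 1))
    ⟨i, by simp [hij]⟩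
  simp only [Finset.mem_Ico] at hq hmin
  have right : ∀ d, q + d < j → q + d + 1 < j → τ (q + d + 1) < τ (q + d + 2) := by
    intro d
    induction d with
    | zero =>
      intro h1 h2
      have := hmin (q + 1) (by omega)
      have h3 : τ (q + 1) ≠ τ (q + 2) := hτ (q + 1) (hM q (by omega) (by omega))
        (hM (q + 1) (by omega) (by omega))
      simp only [add_zero]
      have h4 : τ (q + 1) ≤ τ (q + 2) := this
      omega
    | succ d ih =>
      intro h1 h2
      have := ih (by omega) (by omega)
      rcases hb (q + d + 1) (by omega) (by omega) (hM _ (by omega) (by omega)) with h | h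
      · exact h.2
      · have h5 : τ (q + d + 2) < τ (q + d + 1) := h.2
        omega
  have left : ∀ d p, p + d = q → i < p → τ (p + 1) < τ p := by
    intro d
    induction d with
    | zero =>
      intro p h1 h2
      have := hmin (p - 1) (by omega)
      have hp : p - 1 + 1 = p := by omega
      rw [hp] at this
      have h3 := hτ p (by have := hM (p - 1) (by omega) (by omega); rwa [hp] at this)
        (hM p (by omega) (by omega))
      rw [show q = p by omega] at this
      omega
    | succ d ih =>
      intro p h1 h2
      have := ih (p + 1) (by omega) (by omega)
      rcases hb p (by omega) (by omega) (hM _ (by omega) (by omega)) with h | h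
      · have h5 : τ (p + 1 + 1) < τ (p + 1) := this
        have h6 : τ (p + 1) < τ (p + 1 + 1) := h.2
        omega
      · exact h.2
  refine ⟨q, hq.1, hq.2, ?_, ?_, ?_, ?_⟩
  · intro p h1 h2
    have := right (p - q) (by omega) (by omega)
    rwa [show q + (p - q) = p by omega] at this
  · intro p h1 h2
    exact left (q - p) p (by omega) h1
  · intro h
    have h1 := right (j - 2 - q) (by omega) (by omega)
    rw [show q + (j - 2 - q) + 1 = j - 1 by omega, show q + (j - 2 - q) + 2 = j by omega] at h1
    rcases hb (j - 1) (by omega) (by omega) (hM _ (by omega) (by omega)) with h | h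
    · rw [show j - 1 + 1 = j by omega, show j - 1 + 2 = j + 1 by omega] at h
      exact h
    · rw [show j - 1 + 1 = j by omega] at h
      omega
  · intro h
    have h1 := left (q - (i + 1)) (i + 1) (by omega) (by omega)
    have h1' : τ (i + 2) < τ (i + 1) := h1
    rcases hb i (by omega) (by omega) (hM _ (by omega) (by omega)) with h | h
    · omega
    · exact h

/-- the flow modified by the move -/
def addI (y : ℕ → ℤ) (i j : ℕ) (N : ℤ) : ℕ → ℤ := fun m => y m + if i < m ∧ m ≤ j then N else 0

theorem inS_addI_iff (hy : InS M τ l y) (i j : ℕ) (N : ℤ) (hN : 0 < N)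
    (hM : ∀ p, i ≤ p → p < j → p + 1 ∈ M) (h0 : 0 ∉ M)
    (q : ℕ) (hiq : i ≤ q) (hqj : q < j)
    (hr : ∀ p, q ≤ p → p + 1 < j → τ (p + 1) < τ (p + 2))
    (hL : ∀ p, i < p → p ≤ q → τ (p + 1) < τ p) :
    InS M τ l (addI y i j N) ↔ y (q + 1) + N ≤ l q - l (q + 1) + (if τ q < τ (q + 1) then y q else 0)
      + (if τ (q + 2) < τ (q + 1) then y (q + 2) else 0) := by
  constructor
  · intro h
    have h1 := (h.2 q (hM q hiq hqj)).2
    unfold addI at h1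
    have h2 := hL q
    have h3 := hr q
    rw [if_pos (⟨by omega, by omega⟩ : i < q + 1 ∧ q + 1 ≤ j)] at h1
    split_ifs at * <;> first | linarith | omega
  · intro h
    refine ⟨fun m hm => ?_, fun p hp => ⟨?_, ?_⟩⟩
    · unfold addI
      rw [hy.1 m hm, if_neg, add_zero]
      rintro ⟨h1, h2⟩
      obtain ⟨s, rfl⟩ : ∃ s, m = s + 1 := ⟨m - 1, by omega⟩
      exact hm (hM s (by omega) (by omega))
    · have := (hy.2 p hp).1
      unfold addI
      split_ifs <;> linarith
    · have h1 := (hy.2 p hp).2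
      by_cases hpq : p = q
      · subst hpq
        have h2 := hL p
        have h3 := hr p
        unfold addI
        split_ifs at * <;> first | linarith | omega
      · by_cases hin : i ≤ p ∧ p < j
        · rcases Nat.lt_or_ge p q with h4 | h4
          · have h5 : τ (p + 2) < τ (p + 1) := hL (p + 1) (by omega) (by omega)
            rw [if_pos h5] at h1 ⊢
            unfold addI
            rw [if_pos (⟨by omega, by omega⟩ : i < p + 1 ∧ p + 1 ≤ j),
              if_pos (⟨by omega, by omega⟩ : i < p + 2 ∧ p + 2 ≤ j)]
            split_ifs at * <;> linarith
          · have h5 : τ p < τ (p + 1) := by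
              have := hr (p - 1) (by omega) (by omega)
              rwa [show p - 1 + 1 = p by omega, show p - 1 + 2 = p + 1 by omega] at this
            rw [if_pos h5] at h1 ⊢
            unfold addI
            rw [if_pos (⟨by omega, by omega⟩ : i < p + 1 ∧ p + 1 ≤ j),
              if_pos (⟨by omega, by omega⟩ : i < p ∧ p ≤ j)]
            split_ifs at * <;> linarith
        · unfold addI
          rw [if_neg (by omega : ¬ (i < p + 1 ∧ p + 1 ≤ j))]
          split_ifs at * <;> linarith

theorem core (hl : Antitone l) (h0 : 0 ∉ M)
    (hτ : ∀ p, p ∈ M → p + 1 ∈ M → τ p ≠ τ (p + 1))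
    (hY : GoodY M τ l Y) (hy : InS M τ l y) (i j : ℕ) (hij : i < j)
    (hb : ∀ p, i ≤ p → p < j → p + 1 ∈ M →
      (p + 2 ∈ M ∧ τ (p + 1) < τ (p + 2)) ∨ (p ∈ M ∧ τ (p + 1) < τ p))
    (α β : ℕ → ℤ) (hα : ∀ p, α p = l p + Y p - Y (p + 1))
    (hβ : ∀ p, β p = l p + y p - y (p + 1))
    (N : ℤ) (hN : 0 < N) (hNe : N = β i - β j + (j - i))
    (Lm Rm : ℤ) (hL1 : ∀ r ≤ i, Lm ≤ α r) (hL2 : ∃ r ≤ i, α r = Lm)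
    (hR1 : ∀ r, j ≤ r → α r ≤ Rm) (hR2 : ∃ r, j ≤ r ∧ α r = Rm)
    (q0 : ℕ) (hq0 : ∀ q, i ≤ q → q ≤ j → Rm ≤ α q → (∀ k, q < k → k ≤ j → α k < Rm) → q0 = q) :
    InS M τ l (addI y i j N) ↔ (Lm ≤ β i - N ∧ β j + N ≤ Rm ∧
      (Lm < α i → α j < Rm → addI y i j N (q0 + 1) ≤ Y (q0 + 1))) := by
  have hijZ : (i : ℤ) < j := by exact_mod_cast hij
  have gen : InS M τ l (addI y i j N) → Lm ≤ β i - N ∧ β j + N ≤ Rm := by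
    intro h
    obtain ⟨r, hr, h1⟩ := left_bound hl h0 hτ hY h i
    obtain ⟨s, hs, h2⟩ := right_bound hl h0 hτ hY h j
    have h3 := hL1 r hr
    have h4 := hR1 s hs
    rw [hα] at h3 h4
    unfold addI at h1 h2
    rw [if_neg (by omega), if_pos (⟨by omega, by omega⟩ : i < i + 1 ∧ i + 1 ≤ j)] at h1
    rw [if_neg (by omega : ¬ (i < j + 1 ∧ j + 1 ≤ j)), if_pos (⟨by omega, by omega⟩ : i < j ∧ j ≤ j)] at h2
    rw [hβ i, hβ j]
    constructor <;> linarith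
  by_cases hM : ∀ p, i ≤ p → p < j → p + 1 ∈ M
  swap
  · push Not at hM
    obtain ⟨p, hp1, hp2, hp3⟩ := hM
    constructor
    · intro h
      have := h.1 (p + 1) hp3
      have h2 := hy.1 (p + 1) hp3
      unfold addI at this
      rw [if_pos (⟨by omega, by omega⟩ : i < p + 1 ∧ p + 1 ≤ j)] at this
      omega
    · rintro ⟨h1, -, -⟩
      exfalso
      obtain ⟨r, hr, hr2⟩ := hL2
      have h3 := low_bound_pre' h0 hl (hY.inS hl h0) hY p r (by omega) hp3
      have h4 := suffix_high' h0 hl hy hY p j (by omega) hp3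
      have h5 := hl (Nat.le_succ p)
      rw [← hα] at h3
      rw [← hβ] at h4
      simp only [Nat.succ_eq_add_one] at h5
      linarith
  obtain ⟨q, hiq, hqj, hr, hL, hre, hle⟩ := exists_source hτ i j hij hM hb
  have hiff := inS_addI_iff hy i j N hN hM h0 q hiq hqj hr hL
  have hqM := hM q hiq hqj
  by_cases hB : i ∈ M ∧ τ (i + 1) < τ i
  swap
  · -- case B
    have hqi : q = i := by
      by_contra h
      exact hB (hle (by omega))
    subst hqi
    have hout : q + 2 ∈ M ∧ τ (q + 1) < τ (q + 2) := by
      rcases hb q le_rfl hqj hqM with h | h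
      · exact h
      · exact absurd h hB
    have hyi : ∀ w : ℕ → ℤ, (∀ m, m ∉ M → w m = 0) → (if τ q < τ (q + 1) then w q else 0) = w q := by
      intro w hw
      by_cases h : q ∈ M
      · have := hτ q h hqM
        have h6 : ¬ τ (q + 1) < τ q := by tauto
        rw [if_pos (by omega)]
      · rw [hw q h]; simp
    have hVi : α q = VV τ l Y q := by
      have := hY.2 q hqM
      rw [hyi Y hY.1] at this
      rw [hα]; unfold VV; linarith
    have hVl : VV τ l Y q = l (q + 1) := by
      unfold VV; rw [if_neg (by omega)]; ring
    have hLm : Lm = α q := by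
      apply le_antisymm (hL1 q le_rfl)
      obtain ⟨r, hr, hr2⟩ := hL2
      have h3 := low_bound_pre hl h0 hY (hY.inS hl h0) q r hr hqM
      rw [← hα] at h3
      linarith
    have hiff2 : InS M τ l (addI y q j N) ↔ Lm ≤ β q - N := by
      rw [hiff, hyi y hy.1, if_neg (by omega : ¬ τ (q+2) < τ (q+1)), hLm, hVi, hVl, hβ]
      constructor <;> intro h <;> linarith
    constructor
    · intro h
      refine ⟨(gen h).1, (gen h).2, fun h1 => ?_⟩
      omega
    · rintro ⟨h1, -⟩
      exact hiff2.2 h1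
  by_cases hC : j + 1 ∈ M ∧ τ j < τ (j + 1)
  swap
  · -- case C
    have hqi : q + 1 = j := by
      by_contra h
      exact hC (hre (by omega))
    subst hqi
    have hout : q ∈ M ∧ τ (q + 1) < τ q := by
      rcases hb q hiq hqj hqM with h | h
      · exact absurd h hC
      · exact h
    have hyi : ∀ w : ℕ → ℤ, (∀ m, m ∉ M → w m = 0) →
        (if τ (q + 2) < τ (q + 1) then w (q + 2) else 0) = w (q + 2) := by
      intro w hw
      by_cases h : q + 2 ∈ M
      · have h5 : τ (q + 1) ≠ τ (q + 2) := hτ (q + 1) hqM h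
        have h6 : ¬ τ (q + 1) < τ (q + 2) := fun h6 => hC ⟨h, h6⟩
        rw [if_pos (by omega)]
      · rw [hw _ h]; simp
    have hVi : α (q + 1) = UU τ l Y q := by
      have := hY.2 q hqM
      rw [hyi Y hY.1] at this
      rw [hα]; unfold UU; rw [show q + 1 + 1 = q + 2 by rfl]; linarith
    have hVl : UU τ l Y q = l q := by
      unfold UU; rw [if_neg (by omega)]; ring
    have hLm : Rm = α (q + 1) := by
      apply le_antisymm _ (hR1 (q + 1) le_rfl)
      obtain ⟨r, hr, hr2⟩ := hR2
      have h3 := suffix_high hl h0 hY (hY.inS hl h0) q r hr hqM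
      rw [← hα] at h3
      linarith
    have hiff2 : InS M τ l (addI y i (q + 1) N) ↔ β (q + 1) + N ≤ Rm := by
      rw [hiff, hyi y hy.1, if_neg (by omega : ¬ τ q < τ (q+1)), hLm, hVi, hVl, hβ,
        show q + 1 + 1 = q + 2 by rfl]
      constructor <;> intro h <;> linarith
    constructor
    · intro h
      refine ⟨(gen h).1, (gen h).2, fun _ h1 => ?_⟩
      omega
    · rintro ⟨-, h1, -⟩
      exact hiff2.2 h1
  -- case A
  have hL' : ∀ p, i ≤ p → p ≤ q → p ∈ M ∧ τ (p + 1) < τ p := by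
    intro p h1 h2
    rcases h1.lt_or_eq with h3 | h3
    · refine ⟨?_, hL p h3 h2⟩
      have := hM (p - 1) (by omega) (by omega)
      rwa [show p - 1 + 1 = p by omega] at this
    · rw [← h3]; exact hB
  have hR' : ∀ p, q ≤ p → p < j → p + 2 ∈ M ∧ τ (p + 1) < τ (p + 2) := by
    intro p h1 h2
    by_cases h3 : p + 1 < j
    · exact ⟨hM (p + 1) (by omega) (by omega), hr p h1 h3⟩
    · have : j = p + 1 := by omega
      rw [this] at hC
      exact hC
  have hVq : VV τ l Y q = l (q + 1) := by
    unfold VV; rw [if_neg (by have := (hR' q le_rfl hqj).2; omega)]; ring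
  have hUq : UU τ l Y q = l q := by
    unfold UU; rw [if_neg (by have := (hL' q hiq le_rfl).2; omega)]; ring
  have hVi : VV τ l Y i = l (q + 1) := by
    rw [← hVq]
    have : ∀ d p, p + d = q → i ≤ p → VV τ l Y p = VV τ l Y q := by
      intro d
      induction d with
      | zero => intro p h _; rw [← h]; rfl
      | succ d ih =>
        intro p h1 h2
        have h3 := hL' (p + 1) (by omega) (by omega)
        rw [VV_step hY p h3.2 (hM (p + 1) (by omega) (by omega))]
        exact ih _ (by omega) (by omega)
    exact this (q - i) i (by omega) le_rfl
  have hUj : UU τ l Y (j - 1) = l q := by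
    rw [← hUq]
    have : ∀ d, q + d < j → UU τ l Y (q + d) = UU τ l Y q := by
      intro d
      induction d with
      | zero => intro _; rfl
      | succ d ih =>
        intro h1
        have h3 := hR' (q + d) (by omega) (by omega)
        rw [← add_assoc, UU_step hY (q + d) h3.2 (hM _ (by omega) (by omega))]
        exact ih (by omega)
    have := this (j - 1 - q) (by omega)
    rwa [show q + (j - 1 - q) = j - 1 by omega] at this
  have hLm : Lm = l (q + 1) := by
    rw [← hVi]
    apply le_antisymm
    · obtain ⟨r, hr, h⟩ := exist_low h0 hτ hY i (hM i le_rfl hij)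
      rw [← h, ← hα]; exact hL1 r hr
    · obtain ⟨r, hr, h⟩ := hL2
      have := low_bound_pre hl h0 hY (hY.inS hl h0) i r hr (hM i le_rfl hij)
      rw [← hα] at this
      linarith
  have hj1 : j - 1 + 1 = j := by omega
  have hRm : Rm = l q := by
    rw [← hUj]
    have hjM := hM (j - 1) (by omega) (by omega)
    apply le_antisymm
    · obtain ⟨r, hr, h⟩ := hR2
      have := suffix_high hl h0 hY (hY.inS hl h0) (j - 1) r (by omega) hjM
      rw [← hα] at this
      linarith
    · obtain ⟨r, hr, h⟩ := exist_high' hτ hY (j - 1) hjM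
      rw [← h, ← hα]; exact hR1 r (by omega)
  have hαl : ∀ p, i ≤ p → p ≤ q → l q ≤ α p := by
    intro p h1 h2
    have h3 := hL' p h1 h2
    obtain ⟨s, rfl⟩ : ∃ s, p = s + 1 := ⟨p - 1, by
      rcases p with _ | p
      · exact absurd h3.1 h0
      · rfl⟩
    have h4 := hY.2 (s + 1) (hM (s + 1) h1 (by omega))
    have h6 := hY.2 s h3.1
    have h5 := le_UU hl h0 hY s
    unfold UU at h5
    have h7 : τ (s + 2) < τ (s + 1) := h3.2
    rw [if_pos h7] at h6
    have h8 : l q ≤ l s := hl (by omega)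
    rw [hα, show s + 1 + 1 = s + 2 by rfl]
    linarith [hl (Nat.le_succ s)]
  have hαr : ∀ p, q + 1 ≤ p → p ≤ j → α p ≤ l (q + 1) := by
    intro p h1 h2
    obtain ⟨s, rfl⟩ : ∃ s, p = s + 1 := ⟨p - 1, by omega⟩
    have h3 := hR' s (by omega) (by omega)
    have h6 := hY.2 (s + 1) h3.1
    have h5 := VV_le hl h0 hY (s + 1)
    unfold VV at h5
    have h7 : τ (s + 1) < τ (s + 1 + 1) := h3.2
    rw [if_pos h7] at h6
    have h8 : l (s + 1 + 1) ≤ l (q + 1) := hl (by omega)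
    rw [hα]
    linarith
  have hiff2 : InS M τ l (addI y i j N) ↔ y (q + 1) + N ≤ Y (q + 1) := by
    have h1 := (hL' q hiq le_rfl).2
    have h2 := (hR' q le_rfl hqj).2
    have h3 := hY.2 q hqM
    rw [if_neg (by omega), if_neg (by omega)] at hiff h3
    rw [hiff, h3]
  have hYq : Y (q + 1) = l q - l (q + 1) := by
    have h1 := (hL' q hiq le_rfl).2
    have h2 := (hR' q le_rfl hqj).2
    have h3 := hY.2 q hqM
    rw [if_neg (by omega), if_neg (by omega)] at h3
    linarith
  have hcen : l (q + 1) < l q → q0 = q := by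
    intro hlt
    apply hq0 q hiq (by omega)
    · rw [hRm]; exact hαl q hiq le_rfl
    · intro k h1 h2
      have := hαr k h1 h2
      linarith
  have hadd : addI y i j N (q + 1) = y (q + 1) + N := by
    unfold addI; rw [if_pos (⟨by omega, by omega⟩ : i < q + 1 ∧ q + 1 ≤ j)]
  constructor
  · intro h
    refine ⟨(gen h).1, (gen h).2, fun _ _ => ?_⟩
    have h1 := hiff2.1 h
    have h2 := hy.nonneg h0 (q + 1)
    rw [hcen (by linarith), hadd]
    exact h1
  · rintro ⟨h1, h2, h3⟩
    have hlt : l (q + 1) < l q := by linarith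
    have h4 := h3 (by linarith [hαl i le_rfl hiq]) (by linarith [hαr j (by omega) le_rfl])
    rw [hcen hlt, hadd] at h4
    exact hiff2.2 h4

end arith
end LSS

open scoped Classical
namespace LSS
open MvPolynomial

theorem dvd_sub_rename {n : ℕ} (a b : Fin n) (f : MvPolynomial (Fin n) ℤ) :
    (X a - X b : MvPolynomial (Fin n) ℤ) ∣ f - rename (⇑(Equiv.swap a b)) f := by
  induction f using MvPolynomial.induction_on with
  | C r => simp
  | add p q hp hq =>
    rw [map_add, show p + q - (rename (⇑(Equiv.swap a b)) p + rename (⇑(Equiv.swap a b)) q)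
      = (p - rename (⇑(Equiv.swap a b)) p) + (q - rename (⇑(Equiv.swap a b)) q) by ring]
    exact dvd_add hp hq
  | mul_X p k hp =>
    rw [map_mul, rename_X]
    have hX : (X a - X b : MvPolynomial (Fin n) ℤ) ∣ X k - X (Equiv.swap a b k) := by
      by_cases h1 : k = a
      · subst h1; simp
      · by_cases h2 : k = b
        · subst h2; simp only [Equiv.swap_apply_right]
          exact ⟨-1, by ring⟩
        · rw [Equiv.swap_apply_of_ne_of_ne h1 h2]; simp
    rw [show p * X k - rename (⇑(Equiv.swap a b)) p * X (Equiv.swap a b k) =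
      (p - rename (⇑(Equiv.swap a b)) p) * X k
        + rename (⇑(Equiv.swap a b)) p * (X k - X (Equiv.swap a b k)) by ring]
    exact dvd_add (hp.mul_right _) (hX.mul_left _)

/-- `g` is the Demazure transform of `f` for the pair `a, b`. -/
def IsDem {n : ℕ} (a b : Fin n) (f g : MvPolynomial (Fin n) ℤ) : Prop :=
  (X a - X b) * g = X a * f - X b * rename (⇑(Equiv.swap a b)) f

theorem exists_isDem {n : ℕ} (a b : Fin n) (f : MvPolynomial (Fin n) ℤ) : ∃ g, IsDem a b f g := by
  obtain ⟨q, hq⟩ := dvd_sub_rename a b f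
  refine ⟨f + X b * q, ?_⟩
  unfold IsDem
  linear_combination (-X b) * hq

theorem X_sub_ne {n : ℕ} {a b : Fin n} (h : a ≠ b) : (X a - X b : MvPolynomial (Fin n) ℤ) ≠ 0 := by
  rw [sub_ne_zero]
  intro h2
  exact h (X_injective h2)

theorem IsDem.unique {n : ℕ} {a b : Fin n} (h : a ≠ b) {f g g' : MvPolynomial (Fin n) ℤ}
    (h1 : IsDem a b f g) (h2 : IsDem a b f g') : g = g' :=
  mul_left_cancel₀ (X_sub_ne h) (h1.trans h2.symm)

theorem dem_isDem {n m : ℕ} (h : 0 < m ∧ m < n) (f : MvPolynomial (Fin n) ℤ) :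
    IsDem (⟨m - 1, by omega⟩ : Fin n) ⟨m, h.2⟩ f (dem n m f) := by
  unfold dem
  rw [dif_pos h]
  have hg := exists_isDem (⟨m - 1, by omega⟩ : Fin n) ⟨m, h.2⟩ f
  unfold IsDem at hg
  rw [dif_pos hg]
  exact hg.choose_spec

theorem pred_ne {n m : ℕ} (h : 0 < m ∧ m < n) : (⟨m - 1, by omega⟩ : Fin n) ≠ ⟨m, h.2⟩ := by
  intro h2
  simp at h2
  omega

theorem rename_swap_swap {n : ℕ} (a b : Fin n) (f : MvPolynomial (Fin n) ℤ) :
    rename (⇑(Equiv.swap a b)) (rename (⇑(Equiv.swap a b)) f) = f := by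
  rw [rename_rename]
  have : (⇑(Equiv.swap a b) ∘ ⇑(Equiv.swap a b)) = id := by
    funext x; simp
  rw [this, rename_id_apply]

theorem IsDem.symm {n : ℕ} {a b : Fin n} (h : a ≠ b) {f g : MvPolynomial (Fin n) ℤ}
    (h1 : IsDem a b f g) : rename (⇑(Equiv.swap a b)) g = g := by
  have h2 := congrArg (rename (⇑(Equiv.swap a b))) h1
  unfold IsDem at h1
  simp only [map_mul, map_sub, rename_X, Equiv.swap_apply_left, Equiv.swap_apply_right,
    rename_swap_swap] at h2
  apply mul_left_cancel₀ (X_sub_ne h)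
  linear_combination -h2 - h1

theorem IsDem.idem {n : ℕ} {a b : Fin n} (h : a ≠ b) {f g : MvPolynomial (Fin n) ℤ}
    (h1 : IsDem a b f g) : IsDem a b g g := by
  unfold IsDem
  rw [h1.symm h]; ring

theorem dem_idem (n m : ℕ) (f : MvPolynomial (Fin n) ℤ) : dem n m (dem n m f) = dem n m f := by
  by_cases h : 0 < m ∧ m < n
  · exact (dem_isDem h _).unique (pred_ne h) ((dem_isDem h f).idem (pred_ne h))
  · unfold dem; simp [h]

theorem dem_neg (n m : ℕ) (f : MvPolynomial (Fin n) ℤ) : dem n m (-f) = - dem n m f := by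
  by_cases h : 0 < m ∧ m < n
  · refine (dem_isDem h _).unique (pred_ne h) ?_
    have := dem_isDem h f
    unfold IsDem at *
    rw [map_neg]
    linear_combination -this
  · unfold dem; simp [h]

theorem dem_mul_sym (n m : ℕ) (e f : MvPolynomial (Fin n) ℤ)
    (he : ∀ a b : Fin n, rename (⇑(Equiv.swap a b)) e = e) :
    dem n m (e * f) = e * dem n m f := by
  by_cases h : 0 < m ∧ m < n
  · refine (dem_isDem h _).unique (pred_ne h) ?_
    have := dem_isDem h f
    unfold IsDem at *
    rw [map_mul, he]
    linear_combination e * this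
  · unfold dem; simp [h]

theorem isDem_braid {n : ℕ} {a b c : Fin n} (hab : a ≠ b) (hac : a ≠ c) (hbc : b ≠ c)
    {f g1 g2 g3 k1 k2 k3 : MvPolynomial (Fin n) ℤ}
    (e1 : IsDem a b f g1) (e2 : IsDem b c g1 g2) (e3 : IsDem a b g2 g3)
    (d1 : IsDem b c f k1) (d2 : IsDem a b k1 k2) (d3 : IsDem b c k2 k3) : g3 = k3 := by
  unfold IsDem at *
  have sa : Equiv.swap b c a = a := Equiv.swap_apply_of_ne_of_ne hab hac
  have sc : Equiv.swap a b c = c := Equiv.swap_apply_of_ne_of_ne hac.symm hbc.symm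
  have re1 := congrArg (rename (⇑(Equiv.swap b c))) e1
  have se1 := congrArg (rename (⇑(Equiv.swap a b))) e1
  have sre1 := congrArg (rename (⇑(Equiv.swap a b))) re1
  have se2 := congrArg (rename (⇑(Equiv.swap a b))) e2
  have sd1 := congrArg (rename (⇑(Equiv.swap a b))) d1
  have rd1 := congrArg (rename (⇑(Equiv.swap b c))) d1
  have rsd1 := congrArg (rename (⇑(Equiv.swap b c))) sd1
  have rd2 := congrArg (rename (⇑(Equiv.swap b c))) d2
  have hbr : rename (⇑(Equiv.swap b c)) (rename (⇑(Equiv.swap a b)) (rename (⇑(Equiv.swap b c)) f))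
     = rename (⇑(Equiv.swap a b)) (rename (⇑(Equiv.swap b c)) (rename (⇑(Equiv.swap a b)) f)) := by
    simp only [rename_rename]
    congr 2
    funext x
    simp only [Function.comp]
    by_cases h1 : x = a
    · subst h1; simp [sa, sc]
    · by_cases h2 : x = b
      · subst h2; simp [sa, sc]
      · by_cases h3 : x = c
        · subst h3; simp [sa, sc]
        · simp [Equiv.swap_apply_of_ne_of_ne, h1, h2, h3]
  simp only [map_mul, map_sub, rename_X, Equiv.swap_apply_left, Equiv.swap_apply_right,
    rename_swap_swap, sa, sc, hbr] at re1 se1 sre1 se2 sd1 rd1 rsd1 rd2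
  generalize rename (⇑(Equiv.swap a b)) (rename (⇑(Equiv.swap b c)) (rename (⇑(Equiv.swap a b)) f)) = f5 at *
  generalize rename (⇑(Equiv.swap a b)) (rename (⇑(Equiv.swap b c)) f) = f4 at *
  generalize rename (⇑(Equiv.swap b c)) (rename (⇑(Equiv.swap a b)) f) = f3 at *
  generalize rename (⇑(Equiv.swap a b)) f = f1 at *
  generalize rename (⇑(Equiv.swap b c)) f = f2 at *
  have hx := X_sub_ne hab
  have hy := X_sub_ne hbc
  have hz := X_sub_ne hac
  generalize (X a : MvPolynomial (Fin n) ℤ) = x at *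
  generalize (X b : MvPolynomial (Fin n) ℤ) = y at *
  generalize (X c : MvPolynomial (Fin n) ℤ) = z at *
  set A := x^2*y*f - y^2*x*f1 - x^2*z*f2 + y^2*z*f4 + z^2*x*f3 - z^2*y*f5 with hA
  have H1 : (x - y) * ((x - y)*(y - z)*(x - z)*g3) = (x - y) * A := by
    rw [hA]
    linear_combination e3*((x-y)*(y-z)*(x-z)) + e2*(x*(x-y)*(x-z)) + se2*(-y*(x-y)*(y-z))
      + e1*(x*y*(x-z)) + re1*(-x*z*(x-y)) + se1*(x*y*(y-z)) + sre1*(y*z*(x-y))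
  have H2 : (y - z) * ((x - y)*(y - z)*(x - z)*k3) = (y - z) * A := by
    rw [hA]
    linear_combination d3*((x-y)*(y-z)*(x-z)) + d2*(y*(y-z)*(x-z)) + rd2*(-z*(y-z)*(x-y))
      + d1*(x*y*(x-z)) + sd1*(-y^2*(y-z)) + rd1*(z*x*(x-y)) + rsd1*(z^2*(y-z))
  have H3 := mul_left_cancel₀ hx H1
  have H4 := mul_left_cancel₀ hy H2
  exact mul_left_cancel₀ (mul_ne_zero (mul_ne_zero hx hy) hz) (H3.trans H4.symm)

theorem isDem_comm {n : ℕ} {a b c d : Fin n} (hab : a ≠ b) (hcd : c ≠ d) (hac : a ≠ c) (had : a ≠ d)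
    (hbc : b ≠ c) (hbd : b ≠ d) {f g1 g2 k1 k2 : MvPolynomial (Fin n) ℤ}
    (e1 : IsDem a b f g1) (e2 : IsDem c d g1 g2)
    (d1 : IsDem c d f k1) (d2 : IsDem a b k1 k2) : g2 = k2 := by
  unfold IsDem at *
  have sa : Equiv.swap c d a = a := Equiv.swap_apply_of_ne_of_ne hac had
  have sb : Equiv.swap c d b = b := Equiv.swap_apply_of_ne_of_ne hbc hbd
  have sc : Equiv.swap a b c = c := Equiv.swap_apply_of_ne_of_ne hac.symm hbc.symm
  have sd : Equiv.swap a b d = d := Equiv.swap_apply_of_ne_of_ne had.symm hbd.symm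
  have re1 := congrArg (rename (⇑(Equiv.swap c d))) e1
  have sd1 := congrArg (rename (⇑(Equiv.swap a b))) d1
  have hbr : rename (⇑(Equiv.swap c d)) (rename (⇑(Equiv.swap a b)) f)
     = rename (⇑(Equiv.swap a b)) (rename (⇑(Equiv.swap c d)) f) := by
    simp only [rename_rename]
    congr 2
    funext x
    simp only [Function.comp]
    by_cases h1 : x = a
    · subst h1; simp [sa, sb]
    · by_cases h2 : x = b
      · subst h2; simp [sa, sb]
      · by_cases h3 : x = c
        · subst h3; simp [sc, sd]
        · by_cases h4 : x = d
          · subst h4; simp [sc, sd]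
          · simp [Equiv.swap_apply_of_ne_of_ne, h1, h2, h3, h4]
  simp only [map_mul, map_sub, rename_X, sa, sb, sc, sd, hbr] at re1 sd1
  have hx := X_sub_ne hab
  have hy := X_sub_ne hcd
  apply mul_left_cancel₀ (mul_ne_zero hx hy)
  linear_combination e2 * (X a - X b) + e1 * X c - re1 * X d - d2 * (X c - X d) - d1 * X a + sd1 * X b

theorem dem_braid (n m : ℕ) (h : 0 < m ∧ m + 1 < n) (f : MvPolynomial (Fin n) ℤ) :
    dem n m (dem n (m + 1) (dem n m f)) = dem n (m + 1) (dem n m (dem n (m + 1) f)) := by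
  have h1 : 0 < m ∧ m < n := by omega
  have h2 : 0 < m + 1 ∧ m + 1 < n := by omega
  exact isDem_braid (a := ⟨m - 1, by omega⟩) (b := ⟨m, by omega⟩) (c := ⟨m + 1, by omega⟩)
    (by simp [Fin.ext_iff]; omega) (by simp [Fin.ext_iff]) (by simp [Fin.ext_iff])
    (dem_isDem h1 _) (dem_isDem h2 _) (dem_isDem h1 _)
    (dem_isDem h2 _) (dem_isDem h1 _) (dem_isDem h2 _)

theorem dem_comm (n m k : ℕ) (h : 0 < m ∧ m < n) (hk : 0 < k ∧ k < n) (hmk : m + 1 < k)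
    (f : MvPolynomial (Fin n) ℤ) :
    dem n m (dem n k f) = dem n k (dem n m f) := by
  exact isDem_comm (pred_ne hk) (pred_ne h) 
    (by simp [Fin.ext_iff]; omega) (by simp [Fin.ext_iff]; omega)
    (by simp [Fin.ext_iff]; omega) (by simp [Fin.ext_iff]; omega)
    (dem_isDem hk _) (dem_isDem h _) (dem_isDem h _) (dem_isDem hk _)

end LSS

open scoped Classical
namespace LSS
open MvPolynomial

/-- exponent with the two entries at `a`, `b` replaced -/
noncomputable def upd2 {n : ℕ} (a b : Fin n) (μ : Fin n →₀ ℕ) (s t : ℕ) : Fin n →₀ ℕ :=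
  Finsupp.single a s + Finsupp.single b t + (μ.erase a).erase b

theorem upd2_eq_iff {n : ℕ} {a b : Fin n} (hab : a ≠ b) (μ β : Fin n →₀ ℕ) (s t : ℕ) :
    upd2 a b μ s t = β ↔ β a = s ∧ β b = t ∧ ∀ k, k ≠ a → k ≠ b → β k = μ k := by
  unfold upd2
  rw [Finsupp.ext_iff]
  constructor
  · intro h
    refine ⟨?_, ?_, ?_⟩
    · have := h a; simp [hab, hab.symm] at this; exact this.symm
    · have := h b; simp [hab, hab.symm] at this; exact this.symm
    · intro k h1 h2
      have := h k
      simp [h1, h2, h1.symm, h2.symm] at this; exact this.symm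
  · rintro ⟨h1, h2, h3⟩ k
    by_cases ha : k = a
    · subst ha; simp [hab, h1, hab.symm]
    · by_cases hb : k = b
      · subst hb; simp [hab, h2, hab.symm]
      · have := h3 k ha hb; simp [ha, hb, Ne.symm ha, Ne.symm hb, this]

theorem upd2_self {n : ℕ} {a b : Fin n} (hab : a ≠ b) (μ : Fin n →₀ ℕ) :
    upd2 a b μ (μ a) (μ b) = μ := by
  rw [upd2_eq_iff hab]; simp

theorem monomial_upd2 {n : ℕ} (a b : Fin n) (μ : Fin n →₀ ℕ) (s t : ℕ) :
    (monomial (upd2 a b μ s t) 1 : MvPolynomial (Fin n) ℤ)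
      = X a ^ s * X b ^ t * monomial ((μ.erase a).erase b) 1 := by
  unfold upd2
  rw [X_pow_eq_monomial, X_pow_eq_monomial, monomial_mul, monomial_mul]
  simp

theorem rename_monomial_upd2 {n : ℕ} {a b : Fin n} (hab : a ≠ b) (μ : Fin n →₀ ℕ) (s t : ℕ) :
    rename (⇑(Equiv.swap a b)) (monomial (upd2 a b μ s t) 1 : MvPolynomial (Fin n) ℤ)
      = monomial (upd2 a b μ t s) 1 := by
  rw [rename_monomial]
  refine congrArg (fun e => monomial e (1:ℤ)) ?_
  symm
  rw [upd2_eq_iff hab]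
  have hm : ∀ k, Finsupp.mapDomain (⇑(Equiv.swap a b)) (upd2 a b μ s t) k
      = upd2 a b μ s t (Equiv.swap a b k) := by
    intro k
    have h := Finsupp.mapDomain_apply (Equiv.swap a b).injective (upd2 a b μ s t) (Equiv.swap a b k)
    rwa [Equiv.swap_apply_self] at h
  have h1 := (upd2_eq_iff hab μ _ s t).1 rfl
  refine ⟨?_, ?_, ?_⟩
  · rw [hm, Equiv.swap_apply_left]; exact h1.2.1
  · rw [hm, Equiv.swap_apply_right]; exact h1.1
  · intro k ha hb
    rw [hm, Equiv.swap_apply_of_ne_of_ne ha hb]; exact h1.2.2 k ha hb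

/-- the string polynomial -/
noncomputable def strPoly {n : ℕ} (a b : Fin n) (μ : Fin n →₀ ℕ) : MvPolynomial (Fin n) ℤ :=
  ∑ t ∈ Finset.range (μ a - μ b + 1), monomial (upd2 a b μ (μ b + t) (μ a - t)) 1

theorem isDem_strPoly {n : ℕ} {a b : Fin n} (hab : a ≠ b) (μ : Fin n →₀ ℕ) (h : μ b ≤ μ a) :
    IsDem a b (monomial μ 1) (strPoly a b μ) := by
  unfold IsDem
  have e1 : (monomial μ 1 : MvPolynomial (Fin n) ℤ) = monomial (upd2 a b μ (μ a) (μ b)) 1 := by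
    rw [upd2_self hab]
  rw [e1, rename_monomial_upd2 hab, monomial_upd2, monomial_upd2]
  unfold strPoly
  simp only [monomial_upd2]
  obtain ⟨k, hk⟩ := Nat.exists_eq_add_of_le h
  rw [hk, show μ b + k - μ b = k by omega]
  generalize μ b = B
  generalize (X a : MvPolynomial (Fin n) ℤ) = x
  generalize (X b : MvPolynomial (Fin n) ℤ) = y
  generalize (monomial ((μ.erase a).erase b) 1 : MvPolynomial (Fin n) ℤ) = r
  have hs : ∀ t ∈ Finset.range (k + 1), x ^ (B + t) * y ^ (B + k - t) * r
      = (x ^ B * y ^ B * r) * (x ^ t * y ^ (k + 1 - 1 - t)) := by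
    intro t ht
    rw [Finset.mem_range] at ht
    rw [show B + k - t = B + (k + 1 - 1 - t) by omega, pow_add, pow_add]; ring
  rw [Finset.sum_congr rfl hs, ← Finset.mul_sum]
  have := Commute.geom_sum₂_mul (Commute.all x y) (k + 1)
  linear_combination (x ^ B * y ^ B * r) * this

theorem dem_eq_sum {n m : ℕ} (h : 0 < m ∧ m < n) (f : MvPolynomial (Fin n) ℤ)
    (hdom : ∀ μ, coeff μ f ≠ 0 → μ ⟨m, h.2⟩ ≤ μ ⟨m - 1, by omega⟩) :
    dem n m f = ∑ μ ∈ f.support, C (coeff μ f) * strPoly ⟨m - 1, by omega⟩ ⟨m, h.2⟩ μ := by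
  refine (dem_isDem h f).unique (pred_ne h) ?_
  have hf : f = ∑ μ ∈ f.support, C (coeff μ f) * monomial μ 1 := by
    conv_lhs => rw [f.as_sum]
    refine Finset.sum_congr rfl fun μ _ => ?_
    rw [C_mul_monomial, mul_one]
  unfold IsDem
  conv_rhs => rw [hf]
  rw [map_sum, Finset.mul_sum, Finset.mul_sum, Finset.mul_sum, ← Finset.sum_sub_distrib]
  refine Finset.sum_congr rfl fun μ hμ => ?_
  have := isDem_strPoly (pred_ne h) μ (hdom μ (mem_support_iff.1 hμ))
  unfold IsDem at this
  rw [map_mul, rename_C]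
  linear_combination C (coeff μ f) * this

theorem coeff_strPoly {n : ℕ} {a b : Fin n} (hab : a ≠ b) (μ β : Fin n →₀ ℕ) (h : μ b ≤ μ a) :
    0 ≤ coeff β (strPoly a b μ) ∧ (coeff β (strPoly a b μ) ≠ 0 ↔
      ((∀ k, k ≠ a → k ≠ b → β k = μ k) ∧ β a + β b = μ a + μ b ∧ μ b ≤ β a ∧ β a ≤ μ a)) := by
  unfold strPoly
  rw [coeff_sum]
  simp only [coeff_monomial]
  have hnn : ∀ t ∈ Finset.range (μ a - μ b + 1),
      (0 : ℤ) ≤ if upd2 a b μ (μ b + t) (μ a - t) = β then 1 else 0 := by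
    intro t _; split_ifs <;> norm_num
  refine ⟨Finset.sum_nonneg hnn, ?_⟩
  rw [Ne, Finset.sum_eq_zero_iff_of_nonneg hnn]
  push Not
  simp only [Finset.mem_range, upd2_eq_iff hab]
  constructor
  · rintro ⟨t, ht, h2⟩
    have h3 : β a = μ b + t ∧ β b = μ a - t ∧ ∀ k, k ≠ a → k ≠ b → β k = μ k := by
      by_contra h4
      rw [if_neg h4] at h2
      exact h2 rfl
    refine ⟨h3.2.2, ?_, ?_, ?_⟩ <;> omega
  · rintro ⟨h1, h2, h3, h4⟩
    refine ⟨β a - μ b, by omega, ?_⟩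
    rw [if_pos ⟨by omega, by omega, h1⟩]
    norm_num

theorem dem_coeff {n m : ℕ} (h : 0 < m ∧ m < n) (f : MvPolynomial (Fin n) ℤ)
    (hpos : ∀ μ, 0 ≤ coeff μ f)
    (hdom : ∀ μ, coeff μ f ≠ 0 → μ ⟨m, h.2⟩ ≤ μ ⟨m - 1, by omega⟩) :
    (∀ β, 0 ≤ coeff β (dem n m f)) ∧ ∀ β, coeff β (dem n m f) ≠ 0 ↔
      ∃ μ, coeff μ f ≠ 0 ∧ (∀ k, k ≠ (⟨m - 1, by omega⟩ : Fin n) → k ≠ ⟨m, h.2⟩ → β k = μ k) ∧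
        β ⟨m - 1, by omega⟩ + β ⟨m, h.2⟩ = μ ⟨m - 1, by omega⟩ + μ ⟨m, h.2⟩ ∧
        μ ⟨m, h.2⟩ ≤ β ⟨m - 1, by omega⟩ ∧ β ⟨m - 1, by omega⟩ ≤ μ ⟨m - 1, by omega⟩ := by
  rw [dem_eq_sum h f hdom]
  have hnn : ∀ β, ∀ μ ∈ f.support,
      0 ≤ coeff β (C (coeff μ f) * strPoly (⟨m - 1, by omega⟩ : Fin n) ⟨m, h.2⟩ μ) := by
    intro β μ hμ
    rw [coeff_C_mul]
    exact mul_nonneg (hpos μ) (coeff_strPoly (pred_ne h) μ β (hdom μ (mem_support_iff.1 hμ))).1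
  constructor
  · intro β
    rw [coeff_sum]
    exact Finset.sum_nonneg (hnn β)
  · intro β
    rw [coeff_sum, Ne, Finset.sum_eq_zero_iff_of_nonneg (hnn β)]
    push Not
    constructor
    · rintro ⟨μ, hμ, h1⟩
      have h2 := mem_support_iff.1 hμ
      rw [coeff_C_mul] at h1
      exact ⟨μ, h2, ((coeff_strPoly (pred_ne h) μ β (hdom μ h2)).2).1 (right_ne_zero_of_mul h1)⟩
    · rintro ⟨μ, h2, h3⟩
      refine ⟨μ, mem_support_iff.2 h2, ?_⟩
      rw [coeff_C_mul]
      exact mul_ne_zero h2 (((coeff_strPoly (pred_ne h) μ β (hdom μ h2)).2).2 h3)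

/-- dot-action antisymmetry of a single operator on monomials -/
theorem dem_mono_swap {n m : ℕ} (h : 0 < m ∧ m < n) (b : Fin n → ℕ) :
    dem n m (mono n (fun p => b (st n m p) + p.1)) = - dem n m (mono n (fun p => b p + p.1)) := by
  have hne := pred_ne h
  have key : ∀ b : Fin n → ℕ, mono n (fun p => b p + p.1) =
      monomial (upd2 ⟨m - 1, by omega⟩ ⟨m, h.2⟩ (expOf n (fun p => b p + p.1))
        (b ⟨m - 1, by omega⟩ + (m - 1)) (b ⟨m, h.2⟩ + m)) 1 := by
    intro b
    unfold mono
    refine congrArg (fun e => monomial e (1:ℤ)) ?_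
    symm
    rw [upd2_eq_iff hne]
    refine ⟨rfl, rfl, fun _ _ _ => rfl⟩
  have hrest : ((expOf n (fun p => b (st n m p) + p.1)).erase (⟨m - 1, by omega⟩ : Fin n)).erase ⟨m, h.2⟩ =
      ((expOf n (fun p => b p + p.1)).erase ⟨m - 1, by omega⟩).erase ⟨m, h.2⟩ := by
    ext k
    by_cases h1 : k = ⟨m, h.2⟩
    · subst h1; simp
    · by_cases h2 : k = ⟨m - 1, by omega⟩
      · subst h2; simp [Finsupp.erase_ne h1]
      · rw [Finsupp.erase_ne h1, Finsupp.erase_ne h2, Finsupp.erase_ne h1, Finsupp.erase_ne h2]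
        show b (st n m k) + k.1 = b k + k.1
        unfold st
        rw [dif_pos h, Equiv.swap_apply_of_ne_of_ne h2 h1]
  have hs1 : st n m ⟨m - 1, by omega⟩ = ⟨m, h.2⟩ := by
    unfold st; rw [dif_pos h, Equiv.swap_apply_left]
  have hs2 : st n m ⟨m, h.2⟩ = ⟨m - 1, by omega⟩ := by
    unfold st; rw [dif_pos h, Equiv.swap_apply_right]
  refine (dem_isDem h _).unique hne ?_
  have hd := dem_isDem h (mono n (fun p => b p + p.1))
  unfold IsDem at *
  rw [key b, rename_monomial_upd2 hne] at hd
  rw [key (fun p => b (st n m p)), rename_monomial_upd2 hne, key b]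
  simp only [monomial_upd2] at *
  rw [hrest, hs1, hs2]
  have hm : m = (m - 1) + 1 := by omega
  rw [mul_neg, hd]
  generalize (monomial (((expOf n (fun p => b p + p.1)).erase ⟨m - 1, by omega⟩).erase ⟨m, h.2⟩) 1 :
    MvPolynomial (Fin n) ℤ) = r
  generalize b ⟨m - 1, by omega⟩ = A
  generalize b ⟨m, h.2⟩ = B
  generalize (X (⟨m - 1, by omega⟩ : Fin n) : MvPolynomial (Fin n) ℤ) = x
  generalize (X (⟨m, h.2⟩ : Fin n) : MvPolynomial (Fin n) ℤ) = y
  obtain ⟨s, rfl⟩ : ∃ s, m = s + 1 := ⟨m - 1, by omega⟩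
  simp only [Nat.add_sub_cancel]
  ring

end LSS

open scoped Classical
namespace LSS
open MvPolynomial

theorem st_val {n m : ℕ} (h : 0 < m ∧ m < n) (a : Fin n) :
    (st n m a).1 = if a.1 = m - 1 then m else if a.1 = m then m - 1 else a.1 := by
  unfold st
  rw [dif_pos h]
  rw [Equiv.swap_apply_def]
  simp only [Fin.ext_iff]
  split_ifs <;> rfl

theorem st_st {n m : ℕ} (h : 0 < m ∧ m < n) (a : Fin n) : st n m (st n m a) = a := by
  ext
  rw [st_val h, st_val h]
  split_ifs <;> omega

theorem st_mul_st (n m : ℕ) : st n m * st n m = 1 := by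
  by_cases h : 0 < m ∧ m < n
  · ext a; simp [st_st h]
  · unfold st; rw [dif_neg h]; simp

theorem st_inv (n m : ℕ) : (st n m)⁻¹ = st n m := inv_eq_of_mul_eq_one_left (st_mul_st n m)

theorem st_mul_st_mul (n m : ℕ) (w : Equiv.Perm (Fin n)) : st n m * (st n m * w) = w := by
  rw [← mul_assoc, st_mul_st, one_mul]

theorem mul_st_mul_st (n m : ℕ) (w : Equiv.Perm (Fin n)) : w * st n m * st n m = w := by
  rw [mul_assoc, st_mul_st, mul_one]

theorem st_left {n m : ℕ} (h : 0 < m ∧ m < n) : st n m ⟨m - 1, by omega⟩ = ⟨m, h.2⟩ := by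
  ext; rw [st_val h]; simp
theorem st_right {n m : ℕ} (h : 0 < m ∧ m < n) : st n m ⟨m, h.2⟩ = ⟨m - 1, by omega⟩ := by
  ext; rw [st_val h]; simp
theorem st_other {n m : ℕ} (h : 0 < m ∧ m < n) (a : Fin n) (h1 : a.1 ≠ m - 1) (h2 : a.1 ≠ m) :
    st n m a = a := by
  ext; rw [st_val h]; simp [h1, h2]

theorem len_mul_st {n m : ℕ} (h : 0 < m ∧ m < n) (w : Equiv.Perm (Fin n))
    (hw : w ⟨m - 1, by omega⟩ < w ⟨m, h.2⟩) : len n (w * st n m) = len n w + 1 := by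
  unfold len
  have hinj : Function.Injective (fun p : Fin n × Fin n => (st n m p.1, st n m p.2)) := by
    rintro ⟨a, b⟩ ⟨c, d⟩ hh
    simp only [Prod.mk.injEq, EmbeddingLike.apply_eq_iff_eq] at hh
    rw [hh.1, hh.2]
  have hlt : ∀ a b : Fin n, a < b → ¬ (a.1 = m - 1 ∧ b.1 = m) → st n m a < st n m b := by
    intro a b hab hne
    rw [Fin.lt_def] at *
    rw [st_val h, st_val h]
    split_ifs <;> omega
  have key : (Finset.univ.filter fun p : Fin n × Fin n =>
      p.1 < p.2 ∧ (w * st n m) p.2 < (w * st n m) p.1) =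
      insert (⟨m - 1, by omega⟩, ⟨m, h.2⟩)
        ((Finset.univ.filter fun p : Fin n × Fin n => p.1 < p.2 ∧ w p.2 < w p.1).image
          (fun p : Fin n × Fin n => (st n m p.1, st n m p.2))) := by
    ext ⟨a, b⟩
    simp only [Finset.mem_filter, Finset.mem_univ, true_and, Finset.mem_insert, Finset.mem_image,
      Prod.mk.injEq, Prod.exists]
    simp only [Equiv.Perm.mul_apply]
    constructor
    · rintro ⟨h1, h2⟩
      by_cases hc : a.1 = m - 1 ∧ b.1 = m
      · left; exact ⟨Fin.ext hc.1, Fin.ext hc.2⟩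
      · right
        exact ⟨st n m a, st n m b, ⟨hlt a b h1 hc, h2⟩, st_st h a, st_st h b⟩
    · rintro (⟨rfl, rfl⟩ | ⟨c, d, ⟨h1, h2⟩, rfl, rfl⟩)
      · refine ⟨Fin.lt_def.2 (by simp; omega), ?_⟩
        rw [st_left h, st_right h]; exact hw
      · rw [st_st h, st_st h]
        refine ⟨hlt c d h1 ?_, h2⟩
        rintro ⟨h3, h4⟩
        have e1 : c = ⟨m - 1, by omega⟩ := Fin.ext h3
        have e2 : d = ⟨m, h.2⟩ := Fin.ext h4
        rw [e1, e2] at h2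
        exact absurd hw (not_lt.2 h2.le)
  rw [key, Finset.card_insert_of_notMem, Finset.card_image_of_injective _ hinj]
  intro hmem
  simp only [Finset.mem_filter, Finset.mem_univ, true_and, Finset.mem_image,
    Prod.mk.injEq, Prod.exists] at hmem
  obtain ⟨c, d, ⟨h1, h2⟩, h3, h4⟩ := hmem
  have e1 : c = ⟨m, h.2⟩ := by rw [← st_st h c, h3, st_left h]
  have e2 : d = ⟨m - 1, by omega⟩ := by rw [← st_st h d, h4, st_right h]
  rw [e1, e2, Fin.lt_def] at h1
  simp at h1
  omega

theorem len_inv (n : ℕ) (w : Equiv.Perm (Fin n)) : len n w⁻¹ = len n w := by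
  unfold len
  refine Finset.card_bij' (fun p _ => (w⁻¹ p.2, w⁻¹ p.1)) (fun p _ => (w p.2, w p.1)) ?_ ?_ ?_ ?_
  · rintro ⟨a, b⟩ hp
    simp at hp ⊢
    exact ⟨hp.2, hp.1⟩
  · rintro ⟨a, b⟩ hp
    simp at hp ⊢
    exact ⟨hp.2, hp.1⟩
  · rintro ⟨a, b⟩ hp
    simp
  · rintro ⟨a, b⟩ hp
    simp

theorem len_st_mul {n m : ℕ} (h : 0 < m ∧ m < n) (w : Equiv.Perm (Fin n))
    (hw : w⁻¹ ⟨m - 1, by omega⟩ < w⁻¹ ⟨m, h.2⟩) : len n (st n m * w) = len n w + 1 := by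
  rw [← len_inv, mul_inv_rev, st_inv, len_mul_st h _ hw, len_inv]

theorem len_st_mul_desc {n m : ℕ} (h : 0 < m ∧ m < n) (w : Equiv.Perm (Fin n))
    (hw : w⁻¹ ⟨m, h.2⟩ < w⁻¹ ⟨m - 1, by omega⟩) : len n (st n m * w) + 1 = len n w := by
  have := len_st_mul h (st n m * w) (by
    rw [mul_inv_rev, st_inv, Equiv.Perm.mul_apply, Equiv.Perm.mul_apply, st_left h, st_right h]
    exact hw)
  rw [st_mul_st_mul] at this
  exact this.symm

theorem desc_or {n m : ℕ} (h : 0 < m ∧ m < n) (w : Equiv.Perm (Fin n)) :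
    w⁻¹ ⟨m - 1, by omega⟩ < w⁻¹ ⟨m, h.2⟩ ∨ w⁻¹ ⟨m, h.2⟩ < w⁻¹ ⟨m - 1, by omega⟩ := by
  apply lt_or_gt_of_ne
  intro hh
  exact pred_ne h (w⁻¹.injective hh)

theorem desc_iff {n m : ℕ} (h : 0 < m ∧ m < n) (w : Equiv.Perm (Fin n)) :
    len n (st n m * w) < len n w ↔ w⁻¹ ⟨m, h.2⟩ < w⁻¹ ⟨m - 1, by omega⟩ := by
  rcases desc_or h w with h1 | h1
  · have := len_st_mul h w h1
    constructor
    · intro; omega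
    · intro h2; exact absurd h1 (not_lt.2 h2.le)
  · have := len_st_mul_desc h w h1
    constructor
    · intro; exact h1
    · intro; omega

theorem len_st_mul_le (n m : ℕ) (w : Equiv.Perm (Fin n)) :
    len n (st n m * w) ≤ len n w + 1 := by
  by_cases h : 0 < m ∧ m < n
  · rcases desc_or h w with h1 | h1
    · rw [len_st_mul h w h1]
    · have := len_st_mul_desc h w h1; omega
  · unfold st; rw [dif_neg h, one_mul]; omega

theorem len_one (n : ℕ) : len n 1 = 0 := by
  unfold len
  rw [Finset.card_eq_zero, Finset.filter_eq_empty_iff]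
  rintro ⟨a, b⟩ _ ⟨h1, h2⟩
  exact absurd h1 (not_lt.2 (le_of_lt h2))

theorem len_prod_le (n : ℕ) (L : List ℕ) : len n (L.map (st n)).prod ≤ L.length := by
  induction L with
  | nil => simp [len_one]
  | cons a L ih =>
    rw [List.map_cons, List.prod_cons, List.length_cons]
    exact (len_st_mul_le n a _).trans (by omega)

theorem eq_one_of_no_desc {n : ℕ} (w : Equiv.Perm (Fin n))
    (hw : ∀ m (h : 0 < m ∧ m < n), w ⟨m - 1, by omega⟩ < w ⟨m, h.2⟩) : w = 1 := by
  have hs : StrictMono w := by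
    have : ∀ k a : ℕ, ∀ (h : a + k + 1 < n), w ⟨a, by omega⟩ < w ⟨a + k + 1, h⟩ := by
      intro k
      induction k with
      | zero => intro a h; exact hw (a + 1) ⟨by omega, h⟩
      | succ k ih =>
        intro a h
        exact (ih a (by omega)).trans (hw (a + (k + 1) + 1) ⟨by omega, h⟩)
    intro a b hab
    have h1 : a.1 + (b.1 - a.1 - 1) + 1 = b.1 := by have := Fin.lt_def.1 hab; omega
    have h2 := this (b.1 - a.1 - 1) a.1 (by rw [h1]; exact b.2)
    have e : (⟨a.1 + (b.1 - a.1 - 1) + 1, by rw [h1]; exact b.2⟩ : Fin n) = b := Fin.ext h1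
    rw [e] at h2
    exact h2
  have hge : ∀ k, ∀ (h : k < n), k ≤ (w ⟨k, h⟩).1 := by
    intro k
    induction k with
    | zero => intro h; exact Nat.zero_le _
    | succ k ih =>
      intro h
      have h1 := ih (by omega)
      have h2 := Fin.lt_def.1 (hs (show (⟨k, by omega⟩ : Fin n) < ⟨k + 1, h⟩ from Fin.lt_def.2 (by simp)))
      omega
  have hle : ∀ k, ∀ (h : k < n), (w ⟨n - 1 - k, by omega⟩).1 ≤ n - 1 - k := by
    intro k
    induction k with
    | zero => intro h; have := (w ⟨n - 1 - 0, by omega⟩).2; omega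
    | succ k ih =>
      intro h
      have h1 := ih (by omega)
      have h2 := Fin.lt_def.1 (hs (show (⟨n - 1 - (k + 1), by omega⟩ : Fin n) < ⟨n - 1 - k, by omega⟩
        from Fin.lt_def.2 (by simp; omega)))
      omega
  ext x
  have h1 := hge x.1 x.2
  have h2 := hle (n - 1 - x.1) (by omega)
  have e : (⟨n - 1 - (n - 1 - x.1), by omega⟩ : Fin n) = x := Fin.ext (by simp; omega)
  rw [e] at h2
  simp only [Fin.eta] at h1
  simp
  omega

theorem exists_left_desc {n : ℕ} (w : Equiv.Perm (Fin n)) (hw : w ≠ 1) :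
    ∃ m, ∃ h : 0 < m ∧ m < n, w⁻¹ ⟨m, h.2⟩ < w⁻¹ ⟨m - 1, by omega⟩ := by
  by_contra hc
  push Not at hc
  apply hw
  have : w⁻¹ = 1 := by
    apply eq_one_of_no_desc
    intro m h
    rcases desc_or h w with h1 | h1
    · exact h1
    · exact absurd h1 (not_lt.2 (hc m h))
  rwa [inv_eq_one] at this

theorem IsRedWord.cons {n i : ℕ} (h : 0 < i ∧ i < n) {w : Equiv.Perm (Fin n)} {K : List ℕ}
    (hl : len n (st n i * w) + 1 = len n w) (hK : IsRedWord n K (st n i * w)) :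
    IsRedWord n (i :: K) w := by
  obtain ⟨h1, h2, h3⟩ := hK
  refine ⟨?_, ?_, ?_⟩
  · intro a ha
    rcases List.mem_cons.1 ha with rfl | ha
    · omega
    · exact h1 a ha
  · rw [List.map_cons, List.prod_cons, h2, st_mul_st_mul]
  · rw [List.length_cons, h3, hl]

theorem IsRedWord.uncons {n i : ℕ} {w : Equiv.Perm (Fin n)} {K : List ℕ}
    (hK : IsRedWord n (i :: K) w) :
    (0 < i ∧ i < n) ∧ len n (st n i * w) + 1 = len n w ∧ IsRedWord n K (st n i * w) := by
  obtain ⟨h1, h2, h3⟩ := hK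
  have hi : 0 < i ∧ i < n := by
    have := h1 i (by simp); omega
  rw [List.map_cons, List.prod_cons] at h2
  have h4 : st n i * w = (K.map (st n)).prod := by rw [← h2, st_mul_st_mul]
  rw [List.length_cons] at h3
  have h5 : len n (st n i * w) ≤ K.length := by rw [h4]; exact len_prod_le n K
  have h6 : len n w ≤ len n (st n i * w) + 1 := by
    have := len_st_mul_le n i (st n i * w); rwa [st_mul_st_mul] at this
  refine ⟨hi, by omega, fun a ha => h1 a (List.mem_cons_of_mem _ ha), h4.symm, by omega⟩

theorem exists_redWord (n : ℕ) : ∀ N (w : Equiv.Perm (Fin n)), len n w = N → ∃ L, IsRedWord n L w := by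
  intro N
  induction N with
  | zero =>
    intro w hw
    by_cases h1 : w = 1
    · subst h1; exact ⟨[], by simp, by simp, by simp [len_one]⟩
    · obtain ⟨m, h, hd⟩ := exists_left_desc w h1
      have := len_st_mul_desc h w hd
      omega
  | succ N ih =>
    intro w hw
    by_cases h1 : w = 1
    · subst h1; rw [len_one] at hw; omega
    · obtain ⟨m, h, hd⟩ := exists_left_desc w h1
      have := len_st_mul_desc h w hd
      obtain ⟨L, hL⟩ := ih (st n m * w) (by omega)
      exact ⟨m :: L, hL.cons h this⟩

theorem len_mul_le (n : ℕ) (u v : Equiv.Perm (Fin n)) : len n (u * v) ≤ len n u + len n v := by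
  obtain ⟨A, -, hA, hA'⟩ := exists_redWord n _ u rfl
  obtain ⟨B, -, hB, hB'⟩ := exists_redWord n _ v rfl
  have := len_prod_le n (A ++ B)
  rw [List.map_append, List.prod_append, hA, hB, List.length_append, hA', hB'] at this
  exact this

theorem st_comm {n i j : ℕ} (hi : 0 < i ∧ i < n) (hj : 0 < j ∧ j < n) (hij : i + 1 < j) :
    st n i * st n j = st n j * st n i := by
  ext a
  simp only [Equiv.Perm.mul_apply]
  rw [st_val hi, st_val hj, st_val hj, st_val hi]
  split_ifs <;> omega

theorem st_braid {n i : ℕ} (hi : 0 < i ∧ i + 1 < n) :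
    st n i * (st n (i + 1) * st n i) = st n (i + 1) * (st n i * st n (i + 1)) := by
  have h1 : 0 < i ∧ i < n := by omega
  have h2 : 0 < i + 1 ∧ i + 1 < n := by omega
  have hab : (⟨i - 1, by omega⟩ : Fin n) ≠ ⟨i, h1.2⟩ := by simp [Fin.ext_iff]; omega
  have hac : (⟨i - 1, by omega⟩ : Fin n) ≠ ⟨i + 1, h2.2⟩ := by intro hh; have := congrArg Fin.val hh; dsimp only at this; omega
  have hcb : (⟨i + 1, h2.2⟩ : Fin n) ≠ ⟨i, h1.2⟩ := by simp [Fin.ext_iff]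
  have e1 : st n i = Equiv.swap ⟨i - 1, by omega⟩ ⟨i, h1.2⟩ := by unfold st; rw [dif_pos h1]
  have e2 : st n (i + 1) = Equiv.swap ⟨i, h1.2⟩ ⟨i + 1, h2.2⟩ := by unfold st; rw [dif_pos h2]; rfl
  rw [e1, e2]
  generalize (⟨i - 1, by omega⟩ : Fin n) = a at *
  generalize (⟨i, h1.2⟩ : Fin n) = b at *
  generalize (⟨i + 1, h2.2⟩ : Fin n) = c at *
  have q1 := Equiv.swap_mul_swap_mul_swap hab hac
  have q2 := Equiv.swap_mul_swap_mul_swap hcb hac.symm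
  rw [Equiv.swap_comm b a, Equiv.swap_comm c b, Equiv.swap_comm a c] at q2
  rw [← mul_assoc, ← mul_assoc, q1, q2]

theorem two_desc {n i j : ℕ} (hi : 0 < i ∧ i < n) (hj : 0 < j ∧ j < n) (hij : i < j)
    (w : Equiv.Perm (Fin n))
    (hdi : len n (st n i * w) + 1 = len n w) (hdj : len n (st n j * w) + 1 = len n w) :
    ∃ A B, IsRedWord n (i :: A) w ∧ IsRedWord n (j :: B) w ∧
      ∀ f, demWord n (i :: A) f = demWord n (j :: B) f := by
  have di := (desc_iff hi w).1 (by omega)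
  have dj := (desc_iff hj w).1 (by omega)
  by_cases hc : i + 1 < j
  · have e1 : len n (st n j * (st n i * w)) + 1 = len n (st n i * w) := by
      apply len_st_mul_desc hj
      rw [mul_inv_rev, st_inv, Equiv.Perm.mul_apply, Equiv.Perm.mul_apply,
        st_other hi _ (by simp; omega) (by simp; omega),
        st_other hi _ (by simp; omega) (by simp; omega)]
      exact dj
    have ec : st n j * (st n i * w) = st n i * (st n j * w) := by
      rw [← mul_assoc, ← st_comm hi hj hc, mul_assoc]
    obtain ⟨K, hK⟩ := exists_redWord n _ (st n j * (st n i * w)) rfl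
    refine ⟨j :: K, i :: K, (hK.cons hj e1).cons hi hdi, ?_, ?_⟩
    · rw [ec] at hK
      refine (hK.cons hi ?_).cons hj hdj
      rw [← ec]; omega
    · intro f
      exact dem_comm n i j hi hj hc _
  · obtain rfl : j = i + 1 := by omega
    have e1 : len n (st n (i+1) * (st n i * w)) + 1 = len n (st n i * w) := by
      apply len_st_mul_desc hj
      rw [mul_inv_rev, st_inv, Equiv.Perm.mul_apply, Equiv.Perm.mul_apply,
        st_other hi _ (by simp; omega) (by simp)]
      have : st n i ⟨i + 1 - 1, by omega⟩ = ⟨i - 1, by omega⟩ := st_right hi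
      rw [this]
      exact dj.trans di
    have e2 : len n (st n i * (st n (i+1) * (st n i * w))) + 1 = len n (st n (i+1) * (st n i * w)) := by
      apply len_st_mul_desc hi
      simp only [mul_inv_rev, st_inv, Equiv.Perm.mul_apply]
      have a1 : st n (i + 1) ⟨i, hi.2⟩ = ⟨i + 1, hj.2⟩ := st_left hj
      have a2 : st n (i + 1) ⟨i - 1, by omega⟩ = ⟨i - 1, by omega⟩ :=
        st_other hj _ (by simp only []; omega) (by simp only []; omega)
      rw [a1, a2, st_left hi, st_other hi _ (by simp; omega) (by simp)]
      exact dj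
    have ec : st n i * (st n (i+1) * (st n i * w)) = st n (i+1) * (st n i * (st n (i+1) * w)) := by
      have := congrArg (· * w) (st_braid (n := n) (i := i) ⟨hi.1, hj.2⟩)
      simpa only [mul_assoc] using this
    obtain ⟨K, hK⟩ := exists_redWord n _ (st n i * (st n (i+1) * (st n i * w))) rfl
    refine ⟨(i + 1) :: i :: K, i :: (i+1) :: K, ((hK.cons hi e2).cons hj e1).cons hi hdi, ?_, ?_⟩
    · have q1 := len_st_mul_le n (i+1) (st n (i+1) * (st n i * (st n (i+1) * w)))
      have q2 := len_st_mul_le n i (st n i * (st n (i+1) * w))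
      have q3 := len_st_mul_le n (i+1) (st n (i+1) * w)
      simp only [st_mul_st_mul] at q1 q2 q3
      rw [ec] at hK e2
      refine ((hK.cons hj ?_).cons hi ?_).cons hj hdj <;> omega
    · intro f
      exact dem_braid n i ⟨hi.1, hj.2⟩ _

theorem matsumoto (n : ℕ) : ∀ N (w : Equiv.Perm (Fin n)) (A B : List ℕ), len n w = N →
    IsRedWord n A w → IsRedWord n B w → ∀ f, demWord n A f = demWord n B f := by
  intro N
  induction N with
  | zero =>
    intro w A B hw hA hB f
    have h1 := hA.2.2
    have h2 := hB.2.2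
    rw [hw, List.length_eq_zero_iff] at h1 h2
    rw [h1, h2]
  | succ N ih =>
    intro w A B hw hA hB f
    match A, B, hA, hB with
    | [], _, hA, _ => have := hA.2.2; simp at this; omega
    | _ :: _, [], _, hB => have := hB.2.2; simp at this; omega
    | i :: A, j :: B, hA, hB =>
      obtain ⟨hi, hli, hA'⟩ := hA.uncons
      obtain ⟨hj, hlj, hB'⟩ := hB.uncons
      have hcons : ∀ (k : ℕ) (K : List ℕ), demWord n (k :: K) f = dem n k (demWord n K f) :=
        fun _ _ => rfl
      rcases lt_trichotomy i j with hij | hij | hij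
      · obtain ⟨A2, B2, hA2, hB2, he⟩ := two_desc hi hj hij w hli hlj
        have e1 := ih (st n i * w) A A2 (by omega) hA' hA2.uncons.2.2 f
        have e2 := ih (st n j * w) B B2 (by omega) hB' hB2.uncons.2.2 f
        rw [hcons, hcons, e1, e2, ← hcons, ← hcons]
        exact he f
      · subst hij
        rw [hcons, hcons, ih _ A B (by omega) hA' hB']
      · obtain ⟨B2, A2, hB2, hA2, he⟩ := two_desc hj hi hij w hlj hli
        have e1 := ih (st n i * w) A A2 (by omega) hA' hA2.uncons.2.2 f
        have e2 := ih (st n j * w) B B2 (by omega) hB' hB2.uncons.2.2 f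
        rw [hcons, hcons, e1, e2, ← hcons, ← hcons]
        exact (he f).symm

end LSS

open scoped Classical
namespace LSS
open MvPolynomial

theorem longest_mul_st {n m : ℕ} (hm : 0 < m ∧ m < n) {I : Set ℕ} (hI : m ∈ I)
    {u : Equiv.Perm (Fin n)} (hu : IsLongest n I u) : len n (u * st n m) + 1 = len n u := by
  have hmem : u * st n m ∈ parab n I :=
    (parab n I).mul_mem hu.1 (Subgroup.subset_closure ⟨m, hI, rfl⟩)
  have h1 := hu.2 _ hmem
  have e : len n (u * st n m) = len n (st n m * u⁻¹) := by
    rw [← len_inv, mul_inv_rev, st_inv]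
  rcases desc_or hm u⁻¹ with h2 | h2
  · have := len_st_mul hm _ h2
    rw [len_inv] at this
    omega
  · have := len_st_mul_desc hm _ h2
    rw [len_inv] at this
    omega

theorem demWord_append (n : ℕ) (A B : List ℕ) (f : MvPolynomial (Fin n) ℤ) :
    demWord n (A ++ B) f = demWord n A (demWord n B f) := by
  unfold demWord; rw [List.foldr_append]

theorem demWord_neg (n : ℕ) (A : List ℕ) (f : MvPolynomial (Fin n) ℤ) :
    demWord n A (-f) = - demWord n A f := by
  induction A with
  | nil => rfl
  | cons a A ih =>
    show dem n a (demWord n A (-f)) = - dem n a (demWord n A f)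
    rw [ih, dem_neg]

theorem demWord_mul_sym (n : ℕ) (A : List ℕ) (e f : MvPolynomial (Fin n) ℤ)
    (he : ∀ a b : Fin n, rename (⇑(Equiv.swap a b)) e = e) :
    demWord n A (e * f) = e * demWord n A f := by
  induction A with
  | nil => rfl
  | cons a A ih =>
    show dem n a (demWord n A (e * f)) = e * dem n a (demWord n A f)
    rw [ih, dem_mul_sym _ _ _ _ he]

theorem demWord_right {n m : ℕ} (hm : 0 < m ∧ m < n) {I : Set ℕ} (hI : m ∈ I)
    {u : Equiv.Perm (Fin n)} (hu : IsLongest n I u) {L : List ℕ} (hL : IsRedWord n L u) :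
    ∃ K, ∀ f, demWord n L f = demWord n K (dem n m f) := by
  have h1 := longest_mul_st hm hI hu
  obtain ⟨K, hK1, hK2, hK3⟩ := exists_redWord n _ (u * st n m) rfl
  have hr : IsRedWord n (K ++ [m]) u := by
    refine ⟨?_, ?_, ?_⟩
    · intro a ha
      rcases List.mem_append.1 ha with ha | ha
      · exact hK1 a ha
      · simp at ha; omega
    · rw [List.map_append, List.prod_append, hK2]
      simp [mul_st_mul_st]
    · rw [List.length_append, hK3]; simpa using h1
  refine ⟨K, fun f => ?_⟩
  rw [matsumoto n _ u L (K ++ [m]) rfl hL hr, demWord_append]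
  rfl

theorem flip_simple {n m : ℕ} (hm : 0 < m ∧ m < n) {I : Set ℕ} (hI : m ∈ I)
    {u : Equiv.Perm (Fin n)} (hu : IsLongest n I u) {L : List ℕ} (hL : IsRedWord n L u)
    (b : Fin n → ℕ) :
    demWord n L (mono n (fun p => b (st n m p) + p.1)) =
      - demWord n L (mono n (fun p => b p + p.1)) := by
  obtain ⟨K, hK⟩ := demWord_right hm hI hu hL
  rw [hK, hK, dem_mono_swap hm, demWord_neg]

theorem flip_swap {n : ℕ} {I : Set ℕ}
    {u : Equiv.Perm (Fin n)} (hu : IsLongest n I u) {L : List ℕ} (hL : IsRedWord n L u) (i : Fin n) :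
    ∀ k, ∀ (hk : i.1 + k + 1 < n), (∀ m, i.1 < m → m ≤ i.1 + k + 1 → m ∈ I) → ∀ b : Fin n → ℕ,
    demWord n L (mono n (fun p => b (Equiv.swap i ⟨i.1 + k + 1, hk⟩ p) + p.1)) =
      - demWord n L (mono n (fun p => b p + p.1)) := by
  intro k
  induction k with
  | zero =>
    intro hk hI b
    have hm : 0 < i.1 + 1 ∧ i.1 + 1 < n := by omega
    have e : Equiv.swap i ⟨i.1 + 0 + 1, hk⟩ = st n (i.1 + 1) := by
      unfold st; rw [dif_pos hm]; rfl
    rw [e]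
    exact flip_simple hm (hI _ (by omega) (by omega)) hu hL b
  | succ k ih =>
    intro hk hI b
    have hm : 0 < i.1 + (k + 1) + 1 ∧ i.1 + (k + 1) + 1 < n := by omega
    have e2 : st n (i.1 + (k + 1) + 1) = Equiv.swap ⟨i.1 + k + 1, by omega⟩ ⟨i.1 + (k + 1) + 1, hk⟩ := by
      unfold st; rw [dif_pos hm]; rfl
    have e : Equiv.swap i ⟨i.1 + (k + 1) + 1, hk⟩ =
        st n (i.1 + (k + 1) + 1) * Equiv.swap i ⟨i.1 + k + 1, by omega⟩ * st n (i.1 + (k + 1) + 1) := by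
      rw [e2, Equiv.swap_mul_swap_mul_swap, Equiv.swap_comm]
      · intro hh; have := congrArg Fin.val hh; dsimp only at this; omega
      · intro hh; have := congrArg Fin.val hh; dsimp only at this; omega
    rw [e]
    have h1 := flip_simple hm (hI _ (by omega) (by omega)) hu hL
      (fun p => b (st n (i.1 + (k + 1) + 1) (Equiv.swap i ⟨i.1 + k + 1, by omega⟩ p)))
    have h2 := ih (by omega) (fun m a b => hI m a (by omega)) (fun p => b (st n (i.1 + (k + 1) + 1) p))
    have h3 := flip_simple hm (hI _ (by omega) (by omega)) hu hL b
    rw [h2, h3] at h1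
    rw [neg_neg] at h1
    exact h1

theorem mono_eq_prod (n : ℕ) (a : Fin n → ℕ) : mono n a = ∏ p, X p ^ (a p) := by
  unfold mono
  rw [monomial_eq, C_1, one_mul, Finsupp.prod_fintype]
  · rfl
  · intro; simp

theorem mono_add_const (n N : ℕ) (a : Fin n → ℕ) :
    mono n (fun p => a p + N) = (∏ p, X p) ^ N * mono n a := by
  rw [mono_eq_prod, mono_eq_prod, ← Finset.prod_pow, ← Finset.prod_mul_distrib]
  refine Finset.prod_congr rfl fun p _ => ?_
  rw [pow_add, mul_comm]

theorem flip_t {n k : ℕ} {d : Fin (k + 2) → ℕ} (hd : BlockData n k d)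
    {u : Equiv.Perm (Fin n)} (hu : IsLongest n (Iset n k d) u) {L : List ℕ} (hL : IsRedWord n L u)
    (i j : Fin n) (hij : i < j) (hI : ∀ m, i.1 < m → m ≤ j.1 → m ∈ Iset n k d) (β : Fin n → ℤ)
    (h1 : ∀ p, 0 ≤ β p) (h2 : ∀ p, 0 ≤ tmv n i j β p) :
    demWord n L (mono n (toNatV n (tmv n i j β))) = - demWord n L (mono n (toNatV n β)) := by
  have hij' := Fin.lt_def.1 hij
  have hk : i.1 + (j.1 - i.1 - 1) + 1 = j.1 := by omega
  have hk' : i.1 + (j.1 - i.1 - 1) + 1 < n := by omega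
  have key := flip_swap hu hL i (j.1 - i.1 - 1) hk'
    (fun m a b => hI m a (by omega)) (fun p => (β p).toNat + n - p.1)
  have ej : (⟨i.1 + (j.1 - i.1 - 1) + 1, hk'⟩ : Fin n) = j := Fin.ext hk
  rw [ej] at key
  have f1 : (fun p : Fin n => (β p).toNat + n - p.1 + p.1) = fun p => toNatV n β p + n := by
    funext p; unfold toNatV; omega
  have f2 : (fun p : Fin n => (β (Equiv.swap i j p)).toNat + n - (Equiv.swap i j p).1 + p.1)
      = fun p => toNatV n (tmv n i j β) p + n := by
    funext p
    unfold toNatV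
    have hp := h2 p
    have hg : gapZ n i j = (j.1 : ℤ) - i.1 := rfl
    unfold tmv at hp ⊢
    rw [Equiv.swap_apply_def]
    have hi := h1 i
    have hj := h1 j
    split_ifs at hp ⊢ with c1 c2
    · subst c1; omega
    · subst c2; omega
    · omega
  rw [f1, f2, mono_add_const, mono_add_const] at key
  have hsym : ∀ a b : Fin n, rename (⇑(Equiv.swap a b)) ((∏ p, X p) ^ n : MvPolynomial (Fin n) ℤ)
      = (∏ p, X p) ^ n := by
    intro a b
    rw [map_pow, map_prod]
    simp only [rename_X]
    rw [Equiv.prod_comp (Equiv.swap a b) (fun p => (X p : MvPolynomial (Fin n) ℤ))]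
  rw [demWord_mul_sym _ _ _ _ hsym, demWord_mul_sym _ _ _ _ hsym, ← mul_neg] at key
  refine mul_left_cancel₀ (pow_ne_zero _ (Finset.prod_ne_zero_iff.2 fun p _ => X_ne_zero p)) key

theorem block_I {n k : ℕ} {d : Fin (k + 2) → ℕ} (hd : BlockData n k d) (i j : Fin n)
    (hsb : SameBlock n k d i j) : ∀ m, i.1 < m → m ≤ j.1 → m ∈ Iset n k d := by
  intro m h1 h2
  obtain ⟨t, a1, a2, a3, a4⟩ := hsb
  refine ⟨by omega, by have := j.2; omega, ?_⟩
  rintro ⟨s, -, -, hs⟩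
  have hm := hd.2.2
  rcases le_or_gt s t.castSucc with h | h
  · have := hm.monotone h; omega
  · have h' : t.succ ≤ s := by
      rw [Fin.le_def]; rw [Fin.lt_def] at h; simp at h ⊢; omega
    have := hm.monotone h'; omega

end LSS

open scoped Classical
namespace LSS
open MvPolynomial

/-- integer entries -/
def eZ (n : ℕ) (a : Fin n → ℕ) (p : ℕ) : ℤ := (ent n a p : ℤ)

/-- partial sum differences -/
def yv (l b : ℕ → ℤ) (m : ℕ) : ℤ := ∑ p ∈ Finset.range m, (l p - b p)

theorem yv_zero (l b : ℕ → ℤ) : yv l b 0 = 0 := by simp [yv]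
theorem yv_succ (l b : ℕ → ℤ) (m : ℕ) : yv l b (m + 1) = yv l b m + (l m - b m) := by
  unfold yv; rw [Finset.sum_range_succ]

theorem eq_of_yv (l b : ℕ → ℤ) (p : ℕ) : b p = l p + yv l b p - yv l b (p + 1) := by
  rw [yv_succ]; ring

theorem eZ_nonneg (n : ℕ) (a : Fin n → ℕ) (p : ℕ) : 0 ≤ eZ n a p := by
  unfold eZ; positivity

theorem eZ_fin (n : ℕ) (a : Fin n → ℕ) (p : Fin n) : eZ n a p.1 = a p := by
  unfold eZ ent; rw [dif_pos p.2]

theorem eZ_out (n : ℕ) (a : Fin n → ℕ) (p : ℕ) (h : n ≤ p) : eZ n a p = 0 := by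
  unfold eZ ent; rw [dif_neg (by omega)]; rfl

theorem eZ_antitone {n : ℕ} {lam : Fin n → ℕ} (h : IsPartition n lam) : Antitone (eZ n lam) := by
  intro p q hpq
  by_cases hq : q < n
  · have := h ⟨p, by omega⟩ ⟨q, hq⟩ hpq
    have e1 := eZ_fin n lam ⟨p, by omega⟩
    have e2 := eZ_fin n lam ⟨q, hq⟩
    simp only at e1 e2
    rw [e1, e2]; exact_mod_cast this
  · rw [eZ_out n lam q (by omega)]; exact eZ_nonneg _ _ _

/-- two vectors differing only in two adjacent places with the same sum -/
theorem yv_agree (l b b' : ℕ → ℤ) (p : ℕ) (h : ∀ q, q ≠ p → q ≠ p + 1 → b' q = b q)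
    (hs : b' p + b' (p + 1) = b p + b (p + 1)) :
    yv l b' = Function.update (yv l b) (p + 1) (yv l b (p + 1) + b p - b' p) := by
  have hlow : ∀ q ≤ p, yv l b' q = yv l b q := by
    intro q hq
    unfold yv
    refine Finset.sum_congr rfl fun r hr => ?_
    rw [Finset.mem_range] at hr
    rw [h r (by omega) (by omega)]
  have hmid : yv l b' (p + 1) = yv l b (p + 1) + b p - b' p := by
    rw [yv_succ, yv_succ, hlow p le_rfl]; ring
  have hhigh : ∀ k, yv l b' (p + 2 + k) = yv l b (p + 2 + k) := by
    intro k
    induction k with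
    | zero =>
      show yv l b' (p + 1 + 1) = yv l b (p + 1 + 1)
      rw [yv_succ, hmid, yv_succ l b (p + 1)]; linarith
    | succ k ih =>
      show yv l b' (p + 2 + k + 1) = yv l b (p + 2 + k + 1)
      rw [yv_succ, yv_succ, ih, h _ (by omega) (by omega)]
  funext q
  rcases lt_trichotomy q (p + 1) with hq | hq | hq
  · rw [Function.update_of_ne (by omega), hlow q (by omega)]
  · subst hq; rw [Function.update_self, hmid]
  · rw [Function.update_of_ne (by omega)]
    obtain ⟨k, rfl⟩ : ∃ k, q = p + 2 + k := ⟨q - (p + 2), by omega⟩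
    exact hhigh k

section arith2
variable {M : Finset ℕ} {τ : ℕ → ℕ} {l Y y : ℕ → ℤ}

/-- no neighbour of `p+1` in `M` is later -/
def Late (M : Finset ℕ) (τ : ℕ → ℕ) (p : ℕ) : Prop :=
  (p ∈ M → τ p < τ (p + 1)) ∧ (p + 2 ∈ M → τ (p + 2) < τ (p + 1))

theorem terms_late {p : ℕ} (hl : Late M τ p) {y : ℕ → ℤ} (hy : ∀ m, m ∉ M → y m = 0) :
    (if τ p < τ (p + 1) then y p else 0) = y p ∧
    (if τ (p + 2) < τ (p + 1) then y (p + 2) else 0) = y (p + 2) := by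
  constructor
  · split_ifs with h
    · rfl
    · rw [hy p (fun h2 => h (hl.1 h2))]
  · split_ifs with h
    · rfl
    · rw [hy (p+2) (fun h2 => h (hl.2 h2))]

/-- terms of the other inequalities do not see position `p+1` -/
theorem terms_other {p q : ℕ} (hl : Late M τ p) (hq : q + 1 ∈ M) (hqp : q ≠ p) (y : ℕ → ℤ) (v : ℤ) :
    (if τ q < τ (q + 1) then Function.update y (p + 1) v q else 0) = (if τ q < τ (q + 1) then y q else 0) ∧
    (if τ (q + 2) < τ (q + 1) then Function.update y (p + 1) v (q + 2) else 0)
      = (if τ (q + 2) < τ (q + 1) then y (q + 2) else 0) := by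
  constructor
  · by_cases h : q = p + 1
    · subst h
      have h3 : τ (p + 1 + 1) < τ (p + 1) := hl.2 hq
      rw [if_neg (by omega), if_neg (by omega)]
    · rw [Function.update_of_ne h]
  · by_cases h : q + 2 = p + 1
    · obtain rfl : p = q + 1 := by omega
      have := hl.1 hq
      rw [if_neg (by simp only [Nat.add_assoc, Nat.reduceAdd] at *; omega), if_neg (by simp only [Nat.add_assoc, Nat.reduceAdd] at *; omega)]
    · rw [Function.update_of_ne h]

theorem goodY_erase {p : ℕ} (hp : p + 1 ∈ M) (hl : Late M τ p) :
    GoodY M τ l Y ↔ GoodY (M.erase (p + 1)) τ l (Function.update Y (p + 1) 0) ∧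
      (∀ m, m ∉ M → Y m = 0) ∧ Y (p + 1) = l p - l (p + 1) + Y p + Y (p + 2) := by
  constructor
  · intro h
    refine ⟨⟨?_, ?_⟩, h.1, ?_⟩
    · intro m hm
      by_cases hmp : m = p + 1
      · subst hmp; simp
      · rw [Function.update_of_ne hmp]
        exact h.1 m (fun h2 => hm (Finset.mem_erase.2 ⟨hmp, h2⟩))
    · intro q hq
      obtain ⟨h1, h2⟩ := Finset.mem_erase.1 hq
      have t := terms_other hl h2 (by omega) Y 0
      rw [t.1, t.2, Function.update_of_ne h1]
      exact h.2 q h2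
    · have t := terms_late hl h.1
      have := h.2 p hp
      rwa [t.1, t.2] at this
  · rintro ⟨h1, h2, h3⟩
    refine ⟨h2, ?_⟩
    intro q hq
    by_cases hqp : q = p
    · subst hqp
      have t := terms_late hl h2
      rw [t.1, t.2, h3]
    · have := h1.2 q (Finset.mem_erase.2 ⟨by omega, hq⟩)
      have t := terms_other hl hq hqp Y 0
      rw [t.1, t.2, Function.update_of_ne (by omega)] at this
      exact this

theorem inS_erase {p : ℕ} (hp : p + 1 ∈ M) (hl : Late M τ p) :
    InS M τ l y ↔ InS (M.erase (p + 1)) τ l (Function.update y (p + 1) 0) ∧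
      (∀ m, m ∉ M → y m = 0) ∧ 0 ≤ y (p + 1) ∧ y (p + 1) ≤ l p - l (p + 1) + y p + y (p + 2) := by
  constructor
  · intro h
    refine ⟨⟨?_, ?_⟩, h.1, (h.2 p hp).1, ?_⟩
    · intro m hm
      by_cases hmp : m = p + 1
      · subst hmp; simp
      · rw [Function.update_of_ne hmp]
        exact h.1 m (fun h2 => hm (Finset.mem_erase.2 ⟨hmp, h2⟩))
    · intro q hq
      obtain ⟨h1, h2⟩ := Finset.mem_erase.1 hq
      have t := terms_other hl h2 (by omega) y 0
      rw [t.1, t.2, Function.update_of_ne h1]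
      exact h.2 q h2
    · have t := terms_late hl h.1
      have := (h.2 p hp).2
      rwa [t.1, t.2] at this
  · rintro ⟨h1, h2, h3, h4⟩
    refine ⟨h2, ?_⟩
    intro q hq
    by_cases hqp : q = p
    · subst hqp
      have t := terms_late hl h2
      rw [t.1, t.2]; exact ⟨h3, h4⟩
    · have := h1.2 q (Finset.mem_erase.2 ⟨by omega, hq⟩)
      have t := terms_other hl hq hqp y 0
      rw [t.1, t.2, Function.update_of_ne (by omega)] at this
      exact this

theorem goodY_congr {τ' : ℕ → ℕ} (h : ∀ m ∈ M, τ m = τ' m) (hY : GoodY M τ l Y) : GoodY M τ' l Y := by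
  refine ⟨hY.1, fun p hp => ?_⟩
  have h1 : (if τ p < τ (p + 1) then Y p else 0) = (if τ' p < τ' (p + 1) then Y p else 0) := by
    by_cases hq : p ∈ M
    · rw [h p hq, h _ hp]
    · rw [hY.1 p hq]; simp
  have h2 : (if τ (p+2) < τ (p + 1) then Y (p+2) else 0)
      = (if τ' (p+2) < τ' (p + 1) then Y (p+2) else 0) := by
    by_cases hq : p + 2 ∈ M
    · rw [h _ hq, h _ hp]
    · rw [hY.1 _ hq]; simp
  rw [← h1, ← h2]; exact hY.2 p hp

theorem asc_late (hl : Antitone l) (h0 : 0 ∉ M)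
    (hτ : ∀ p, p ∈ M → p + 1 ∈ M → τ p ≠ τ (p + 1)) (hY : GoodY M τ l Y) (p : ℕ)
    (ha : l p + Y p - Y (p + 1) < l (p + 1) + Y (p + 1) - Y (p + 2)) : p + 1 ∈ M ∧ Late M τ p := by
  have hn := hY.nonneg hl h0
  have h1 := hl (Nat.le_succ p)
  have h2 := hl (Nat.le_succ (p + 1))
  simp only [Nat.succ_eq_add_one] at h1 h2
  have hp : p + 1 ∈ M := by
    by_contra hp
    have := hY.1 _ hp
    have := hn p
    have := hn (p + 2)
    linarith
  refine ⟨hp, ?_, ?_⟩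
  · intro hpM
    by_contra hc
    have hne := hτ p hpM hp
    obtain ⟨s, rfl⟩ : ∃ s, p = s + 1 := ⟨p - 1, by
        rcases p with _ | i
        · exact absurd hpM h0
        · rfl⟩
    have e1 := hY.2 s hpM
    have e2 := hY.2 (s + 1) hp
    have hs := hl (Nat.le_succ s)
    simp only [Nat.succ_eq_add_one] at hs
    have := hn s
    have := hn (s + 1 + 2)
    rw [if_neg hc] at e2
    have hlt : τ (s + 2) < τ (s + 1) := by simp only [Nat.add_assoc, Nat.reduceAdd] at *; omega
    rw [if_pos hlt] at e1
    simp only [Nat.add_assoc, Nat.reduceAdd] at *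
    split_ifs at e1 e2 <;> linarith
  · intro hpM
    by_contra hc
    have hne := hτ (p + 1) hp hpM
    have e1 := hY.2 (p + 1) hpM
    have e2 := hY.2 p hp
    have := hn p
    have := hn (p + 3)
    rw [if_neg hc] at e2
    have hlt : τ (p + 1) < τ (p + 2) := by simp only [Nat.add_assoc, Nat.reduceAdd] at *; omega
    simp only [Nat.add_assoc, Nat.reduceAdd] at *
    rw [if_pos hlt] at e1
    split_ifs at e1 e2 <;> linarith

theorem late_diff (hY : GoodY M τ l Y) (p : ℕ) (hp : p + 1 ∈ M) (hL : Late M τ p) :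
    l p + Y p - Y (p + 1) = l (p + 1) + Y (p + 1) - Y (p + 2) - Y (p + 1) := by
  have := ((goodY_erase hp hL).1 hY).2.2
  linarith

end arith2

/-- time of each letter of a word -/
def tauL : List ℕ → ℕ → ℕ
  | [], _ => 0
  | m :: L, p => if p = m then L.length + 1 else tauL L p

theorem tauL_le (L : List ℕ) (p : ℕ) : tauL L p ≤ L.length := by
  induction L with
  | nil => simp [tauL]
  | cons m L ih => unfold tauL; split_ifs <;> simp; omega

theorem tauL_ne (L : List ℕ) (p q : ℕ) (hp : p ∈ L) (hq : q ∈ L) (hpq : p ≠ q) :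
    tauL L p ≠ tauL L q := by
  induction L with
  | nil => simp at hp
  | cons m L ih =>
    have h1 := tauL_le L p
    have h2 := tauL_le L q
    unfold tauL
    split_ifs with a b b
    · omega
    · omega
    · omega
    · exact ih (by simpa [a] using hp) (by simpa [b] using hq)

theorem eZ_pact_st {n m : ℕ} (h : 0 < m ∧ m < n) (c : Equiv.Perm (Fin n)) (lam : Fin n → ℕ) :
    eZ n (pact n (st n m * c) lam) (m - 1) = eZ n (pact n c lam) m ∧
    eZ n (pact n (st n m * c) lam) m = eZ n (pact n c lam) (m - 1) ∧
    ∀ q, q ≠ m - 1 → q ≠ m → eZ n (pact n (st n m * c) lam) q = eZ n (pact n c lam) q := by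
  have key : ∀ p : Fin n, pact n (st n m * c) lam p = pact n c lam (st n m p) := by
    intro p; unfold pact; rw [mul_inv_rev, st_inv, Equiv.Perm.mul_apply]
  refine ⟨?_, ?_, ?_⟩
  · have e1 := eZ_fin n (pact n (st n m * c) lam) ⟨m - 1, by omega⟩
    have e2 := eZ_fin n (pact n c lam) ⟨m, h.2⟩
    rw [key, st_left h] at e1
    exact e1.trans e2.symm
  · have e1 := eZ_fin n (pact n (st n m * c) lam) ⟨m, h.2⟩
    have e2 := eZ_fin n (pact n c lam) ⟨m - 1, by omega⟩
    rw [key, st_right h] at e1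
    exact e1.trans e2.symm
  · intro q h1 h2
    by_cases hq : q < n
    · have e1 := eZ_fin n (pact n (st n m * c) lam) ⟨q, hq⟩
      have e2 := eZ_fin n (pact n c lam) ⟨q, hq⟩
      rw [key, st_other h _ h1 h2] at e1
      exact e1.trans e2.symm
    · rw [eZ_out _ _ _ (by omega), eZ_out _ _ _ (by omega)]

theorem good_of_word (n : ℕ) (lam : Fin n → ℕ) (L : List ℕ) (hnd : L.Nodup)
    (hv : ∀ i ∈ L, 1 ≤ i ∧ i ≤ n - 1) :
    GoodY L.toFinset (tauL L) (eZ n lam) (yv (eZ n lam) (eZ n (pact n (L.map (st n)).prod lam))) := by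
  induction L with
  | nil =>
    have : pact n (List.map (st n) []).prod lam = lam := by
      funext i; simp [pact]
    rw [this]
    refine ⟨fun m _ => by simp [yv], fun p hp => by simp at hp⟩
  | cons m L ih =>
    have hm : 0 < m ∧ m < n := by have := hv m (by simp); omega
    have ih' := ih (List.nodup_cons.1 hnd).2 (fun i hi => hv i (List.mem_cons_of_mem _ hi))
    have hmL := (List.nodup_cons.1 hnd).1
    rw [List.map_cons, List.prod_cons]
    obtain ⟨e1, e2, e3⟩ := eZ_pact_st hm (L.map (st n)).prod lam
    generalize eZ n (pact n (st n m * (L.map (st n)).prod) lam) = a at *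
    generalize eZ n (pact n (L.map (st n)).prod lam) = a' at *
    generalize eZ n lam = l at *
    obtain ⟨p, rfl⟩ : ∃ p, m = p + 1 := ⟨m - 1, by omega⟩
    simp only [Nat.add_sub_cancel] at e1 e2 e3
    have hup := yv_agree l a' a p e3 (by rw [e1, e2]; ring)
    have hz : yv l a' (p + 1) = 0 := ih'.1 _ (by simpa using hmL)
    have hlate : Late (List.toFinset ((p + 1) :: L)) (tauL ((p + 1) :: L)) p := by
      have h1 := tauL_le L p
      have h2 := tauL_le L (p + 2)
      refine ⟨fun _ => ?_, fun _ => ?_⟩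
      · simp [tauL]; omega
      · simp [tauL]; omega
    rw [goodY_erase (p := p) (by simp) hlate]
    refine ⟨?_, ?_, ?_⟩
    · have hE : (List.toFinset ((p + 1) :: L)).erase (p + 1) = L.toFinset := by
        rw [List.toFinset_cons, Finset.erase_insert (by simpa using hmL)]
      rw [hE, hup, Function.update_idem, ← hz, Function.update_eq_self]
      refine goodY_congr ?_ ih'
      intro q hq
      have : q ≠ p + 1 := by rintro rfl; simp at hq; exact hmL hq
      simp [tauL, this]
    · intro q hq
      simp only [List.toFinset_cons, Finset.mem_insert, not_or] at hq
      rw [hup, Function.update_of_ne hq.1]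
      exact ih'.1 q hq.2
    · rw [hup, Function.update_self, Function.update_of_ne (by omega), Function.update_of_ne (by omega)]
      have q1 := eq_of_yv l a' p
      have q2 := eq_of_yv l a' (p + 1)
      rw [show p + 1 + 1 = p + 2 from rfl] at q2
      rw [hz] at q1 q2 ⊢
      rw [e1]
      linarith

end LSS

open scoped Classical
namespace LSS
open MvPolynomial

theorem expOf_coe {n : ℕ} (μ : Fin n →₀ ℕ) : expOf n (⇑μ) = μ := by
  unfold expOf; ext; rfl

theorem expOf_apply {n : ℕ} (b : Fin n → ℕ) (p : Fin n) : expOf n b p = b p := rfl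

theorem coeffOf_mono {n : ℕ} (a b : Fin n → ℕ) :
    coeffOf n b (mono n a) = if a = b then 1 else 0 := by
  unfold coeffOf mono
  rw [coeff_monomial]
  have : expOf n a = expOf n b ↔ a = b := by
    unfold expOf; exact Finsupp.equivFunOnFinite.symm.injective.eq_iff
  simp only [this]

theorem eZ_inj {n : ℕ} {a b : Fin n → ℕ} (h : ∀ p, eZ n a p = eZ n b p) : a = b := by
  funext p
  have := h p.1
  rw [eZ_fin, eZ_fin] at this
  exact_mod_cast this

theorem keyAux_noasc {n : ℕ} (k : ℕ) (a : Fin n → ℕ)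
    (h : ¬ ∃ p : Fin n, ent n a p.1 < ent n a (p.1 + 1)) : keyAux n k a = mono n a := by
  cases k with
  | zero => rfl
  | succ k => rw [keyAux, dif_neg h]

theorem keyAux_asc {n : ℕ} (k : ℕ) (a : Fin n → ℕ)
    (h : ∃ p : Fin n, ent n a p.1 < ent n a (p.1 + 1)) :
    ∃ p, p + 1 < n ∧ eZ n a p < eZ n a (p + 1) ∧
      keyAux n (k + 1) a = dem n (p + 1) (keyAux n k (swapAt n p a)) := by
  have hs := h.choose_spec
  refine ⟨h.choose.1, ?_, by unfold eZ; exact_mod_cast hs, ?_⟩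
  · by_contra hc
    have hout : ∀ q, ¬ q < n → ent n a q = 0 := fun q hq => by unfold ent; rw [dif_neg hq]
    have := hout _ hc
    omega
  · rw [keyAux, dif_pos h]

theorem eZ_swapAt {n p : ℕ} (hp : p + 1 < n) (a : Fin n → ℕ) :
    eZ n (swapAt n p a) p = eZ n a (p + 1) ∧ eZ n (swapAt n p a) (p + 1) = eZ n a p ∧
    ∀ q, q ≠ p → q ≠ p + 1 → eZ n (swapAt n p a) q = eZ n a q := by
  refine ⟨?_, ?_, ?_⟩
  · have := eZ_fin n (swapAt n p a) ⟨p, by omega⟩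
    simp [swapAt] at this
    exact this
  · have := eZ_fin n (swapAt n p a) ⟨p + 1, by omega⟩
    simp [swapAt] at this
    exact this
  · intro q h1 h2
    by_cases hq : q < n
    · have e1 := eZ_fin n (swapAt n p a) ⟨q, hq⟩
      have e2 := eZ_fin n a ⟨q, hq⟩
      simp [swapAt, h1, h2] at e1
      exact e1.trans e2.symm
    · rw [eZ_out _ _ _ (by omega), eZ_out _ _ _ (by omega)]

theorem key_support (n : ℕ) (lam : Fin n → ℕ) (hlam : IsPartition n lam) (τ : ℕ → ℕ) :
    ∀ N k (M : Finset ℕ) (a : Fin n → ℕ), M.card = N → N ≤ k → (∀ m ∈ M, 1 ≤ m ∧ m ≤ n - 1) →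
    (∀ p, p ∈ M → p + 1 ∈ M → τ p ≠ τ (p + 1)) →
    GoodY M τ (eZ n lam) (yv (eZ n lam) (eZ n a)) →
    (∀ b, 0 ≤ coeffOf n b (keyAux n k a)) ∧
    ∀ b, coeffOf n b (keyAux n k a) ≠ 0 ↔ InS M τ (eZ n lam) (yv (eZ n lam) (eZ n b)) := by
  have hl := eZ_antitone hlam
  intro N
  induction N with
  | zero =>
    intro k M a hM hk hMn hτ hY
    rw [Finset.card_eq_zero] at hM
    subst hM
    have ha : a = lam := by
      apply eZ_inj
      intro p
      rw [eq_of_yv (eZ n lam) (eZ n a) p, hY.1 _ (by simp), hY.1 _ (by simp)]; ring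
    subst ha
    have hno : ¬ ∃ p : Fin n, ent n a p.1 < ent n a (p.1 + 1) := by
      rintro ⟨p, hp⟩
      have := hl (Nat.le_succ p.1)
      unfold eZ at this
      simp only [Nat.succ_eq_add_one] at this
      omega
    rw [keyAux_noasc k a hno]
    refine ⟨fun b => by rw [coeffOf_mono]; split_ifs <;> norm_num, fun b => ?_⟩
    rw [coeffOf_mono]
    constructor
    · intro h
      have hb : a = b := by by_contra hc; rw [if_neg hc] at h; exact h rfl
      subst hb
      refine ⟨fun m _ => by simp [yv], fun p hp => by simp at hp⟩
    · intro h
      have hb : a = b := by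
        apply eZ_inj
        intro p
        rw [eq_of_yv (eZ n a) (eZ n b) p, h.1 _ (by simp), h.1 _ (by simp)]; ring
      rw [if_pos hb]; norm_num
  | succ N ih =>
    intro k M a hM hk hMn hτ hY
    obtain ⟨k, rfl⟩ : ∃ k', k = k' + 1 := ⟨k - 1, by omega⟩
    have h0 : 0 ∉ M := fun h => by have := hMn 0 h; omega
    have hτe : ∀ x, ∀ p, p ∈ M.erase x → p + 1 ∈ M.erase x → τ p ≠ τ (p + 1) := fun x p h1 h2 =>
      hτ p (Finset.mem_of_mem_erase h1) (Finset.mem_of_mem_erase h2)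
    have hMne : ∀ x, ∀ m ∈ M.erase x, 1 ≤ m ∧ m ≤ n - 1 := fun x m h =>
      hMn m (Finset.mem_of_mem_erase h)
    have hcard : ∀ x ∈ M, (M.erase x).card = N := fun x hx => by
      rw [Finset.card_erase_of_mem hx]; omega
    by_cases hasc : ∃ p : Fin n, ent n a p.1 < ent n a (p.1 + 1)
    · obtain ⟨p, hpn, hpa, hkey⟩ := keyAux_asc k a hasc
      obtain ⟨hpM, hlate⟩ := asc_late hl h0 hτ hY p (by
        have e1 := eq_of_yv (eZ n lam) (eZ n a) p
        have e2 := eq_of_yv (eZ n lam) (eZ n a) (p + 1)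
        rw [show p + 1 + 1 = p + 2 from rfl] at e2
        linarith)
      obtain ⟨s1, s2, s3⟩ := eZ_swapAt hpn a
      have hup := yv_agree (eZ n lam) (eZ n a) (eZ n (swapAt n p a)) p s3 (by rw [s1, s2]; ring)
      have hdiff := late_diff hY p hpM hlate
      have hz : yv (eZ n lam) (eZ n a) (p + 1) + eZ n a p - eZ n (swapAt n p a) p = 0 := by
        have e1 := eq_of_yv (eZ n lam) (eZ n a) p
        have e2 := eq_of_yv (eZ n lam) (eZ n a) (p + 1)
        rw [show p + 1 + 1 = p + 2 from rfl] at e2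
        rw [s1]; linarith
      rw [hz] at hup
      have hG' := ((goodY_erase hpM hlate).1 hY).1
      rw [← hup] at hG'
      obtain ⟨ih1, ih2⟩ := ih k (M.erase (p + 1)) (swapAt n p a) (hcard _ hpM) (by omega)
        (hMne _) (hτe _) hG'
      have h0e : 0 ∉ M.erase (p + 1) := fun h => h0 (Finset.mem_of_mem_erase h)
      have hm : 0 < p + 1 ∧ p + 1 < n := ⟨by omega, hpn⟩
      have hcf : ∀ (μ : Fin n →₀ ℕ) f, coeff μ f = coeffOf n (⇑μ) f := by
        intro μ f; unfold coeffOf; rw [expOf_coe]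
      have hzp : ∀ b : Fin n → ℕ, InS (M.erase (p + 1)) τ (eZ n lam) (yv (eZ n lam) (eZ n b)) →
          eZ n b p = eZ n lam p + yv (eZ n lam) (eZ n b) p ∧
          eZ n b (p + 1) = eZ n lam (p + 1) - yv (eZ n lam) (eZ n b) (p + 2) := by
        intro b hb
        have hz := hb.1 (p + 1) (by simp)
        have e1 := eq_of_yv (eZ n lam) (eZ n b) p
        have e2 := eq_of_yv (eZ n lam) (eZ n b) (p + 1)
        rw [show p + 1 + 1 = p + 2 from rfl] at e2
        rw [hz] at e1 e2
        constructor <;> linarith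
      have hv0 : ∀ b : Fin n → ℕ, eZ n b p = b ⟨p, by omega⟩ := fun b => eZ_fin n b ⟨p, by omega⟩
      have hv1 : ∀ b : Fin n → ℕ, eZ n b (p + 1) = b ⟨p + 1, hpn⟩ := fun b => eZ_fin n b ⟨p + 1, hpn⟩
      have hlp := hl (Nat.le_succ p)
      simp only [Nat.succ_eq_add_one] at hlp
      obtain ⟨d1, d2⟩ := dem_coeff hm (keyAux n k (swapAt n p a))
        (fun μ => by rw [hcf]; exact ih1 _)
        (fun μ hμ => by
          rw [hcf, ih2] at hμ
          obtain ⟨e1, e2⟩ := hzp _ hμ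
          have n1 := hμ.nonneg h0e p
          have n2 := hμ.nonneg h0e (p + 2)
          rw [hv0] at e1
          rw [hv1] at e2
          have : ((μ ⟨p + 1, hpn⟩ : ℕ) : ℤ) ≤ (μ ⟨p, by omega⟩ : ℕ) := by linarith
          exact_mod_cast this)
      rw [hkey]
      refine ⟨fun b => d1 _, fun b => ?_⟩
      unfold coeffOf
      rw [d2]
      simp only [expOf_apply, Nat.add_sub_cancel]
      rw [inS_erase hpM hlate]
      constructor
      · rintro ⟨μ, hμ, g1, g2, g3, g4⟩
        rw [hcf, ih2] at hμ
        obtain ⟨e1, e2⟩ := hzp _ hμ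
        have hag : ∀ q, q ≠ p → q ≠ p + 1 → eZ n b q = eZ n (⇑μ) q := by
          intro q h1 h2
          by_cases hq : q < n
          · have e3 := eZ_fin n b ⟨q, hq⟩
            have e4 := eZ_fin n (⇑μ) ⟨q, hq⟩
            rw [g1 ⟨q, hq⟩ (by simp [Fin.ext_iff]; exact h1) (by simp [Fin.ext_iff]; exact h2)] at e3
            exact e3.trans e4.symm
          · rw [eZ_out _ _ _ (by omega), eZ_out _ _ _ (by omega)]
        have hyb := yv_agree (eZ n lam) (eZ n (⇑μ)) (eZ n b) p hag (by
          rw [hv0, hv1, hv0, hv1]; exact_mod_cast g2)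
        have hzz := hμ.1 (p + 1) (by simp)
        rw [hzz] at hyb
        have hback : Function.update (yv (eZ n lam) (eZ n b)) (p + 1) 0 = yv (eZ n lam) (eZ n (⇑μ)) := by
          rw [hyb, Function.update_idem, ← hzz, Function.update_eq_self]
        rw [hback]
        have g3' : eZ n (⇑μ) (p + 1) ≤ eZ n b p := by rw [hv0, hv1]; exact_mod_cast g3
        have g4' : eZ n b p ≤ eZ n (⇑μ) p := by rw [hv0, hv0]; exact_mod_cast g4
        refine ⟨hμ, ?_, ?_, ?_⟩
        · intro m hmM
          have : m ≠ p + 1 := by rintro rfl; exact hmM hpM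
          rw [hyb, Function.update_of_ne this]
          exact hμ.1 m (fun h => hmM (Finset.mem_of_mem_erase h))
        · rw [hyb, Function.update_self]; linarith
        · rw [hyb, Function.update_self, Function.update_of_ne (by omega),
            Function.update_of_ne (by omega)]
          linarith
      · rintro ⟨g1, g2, g3, g4⟩
        set y := yv (eZ n lam) (eZ n b) with hy
        have hny : ∀ q, 0 ≤ y q := by
          intro q
          by_cases hq : q = p + 1
          · subst hq; exact g3
          · have := g1.nonneg h0e q
            rwa [Function.update_of_ne hq] at this
        have hA : 0 ≤ eZ n lam p + y p := add_nonneg (eZ_nonneg _ _ _) (hny p)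
        have hB : 0 ≤ eZ n lam (p + 1) - y (p + 2) := by
          obtain ⟨r, hr, h1⟩ := left_bound hl h0e (hτe _) hG' g1 (p + 1)
          rw [← eq_of_yv, Function.update_self, Function.update_of_ne (by omega)] at h1
          have := eZ_nonneg n (swapAt n p a) r
          simp only [Nat.add_assoc, Nat.reduceAdd] at h1
          linarith
        have b1 := eq_of_yv (eZ n lam) (eZ n b) p
        have b2 := eq_of_yv (eZ n lam) (eZ n b) (p + 1)
        rw [show p + 1 + 1 = p + 2 from rfl] at b2
        rw [← hy] at b1 b2
        let mu : Fin n → ℕ := fun q => if q.1 = p then (eZ n lam p + y p).toNat else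
          if q.1 = p + 1 then (eZ n lam (p + 1) - y (p + 2)).toNat else b q
        have m0 : eZ n mu p = eZ n lam p + y p := by
          rw [hv0]; simp only [mu]; simp [hA]
        have m1 : eZ n mu (p + 1) = eZ n lam (p + 1) - y (p + 2) := by
          rw [hv1]; simp only [mu]; simp; linarith
        have mo : ∀ q : Fin n, q.1 ≠ p → q.1 ≠ p + 1 → mu q = b q := by
          intro q h1 h2
          simp only [mu, if_neg h1, if_neg h2]
        have hag : ∀ q, q ≠ p → q ≠ p + 1 → eZ n mu q = eZ n b q := by
          intro q h1 h2
          by_cases hq : q < n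
          · have e3 := eZ_fin n b ⟨q, hq⟩
            have e4 := eZ_fin n mu ⟨q, hq⟩
            rw [mo ⟨q, hq⟩ h1 h2] at e4
            exact e4.trans e3.symm
          · rw [eZ_out _ _ _ (by omega), eZ_out _ _ _ (by omega)]
        have hym := yv_agree (eZ n lam) (eZ n b) (eZ n mu) p hag (by rw [m0, m1]; linarith)
        rw [← hy, show y (p + 1) + eZ n b p - eZ n mu p = 0 by rw [m0]; linarith] at hym
        have c1 : eZ n mu (p + 1) ≤ eZ n b p := by rw [m1]; linarith
        have c2 : eZ n b p ≤ eZ n mu p := by rw [m0]; linarith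
        have c3 : eZ n b p + eZ n b (p + 1) = eZ n mu p + eZ n mu (p + 1) := by rw [m0, m1]; linarith
        rw [hv0, hv0, hv1, hv1] at c3
        rw [hv0, hv1] at c1
        rw [hv0, hv0] at c2
        refine ⟨expOf n mu, ?_, ?_, ?_, ?_, ?_⟩
        · have := (ih2 mu).2 (by rw [hym]; exact g1)
          exact this
        · intro q h1 h2
          rw [expOf_apply, mo q (fun h => h1 (Fin.ext h)) (fun h => h2 (Fin.ext h))]
        · simp only [expOf_apply]; exact_mod_cast c3
        · simp only [expOf_apply]; exact_mod_cast c1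
        · simp only [expOf_apply]; exact_mod_cast c2
    · obtain ⟨m, hmM, hmax⟩ := Finset.exists_max_image M τ (Finset.card_pos.1 (by omega))
      obtain ⟨p, rfl⟩ : ∃ p, m = p + 1 := ⟨m - 1, by have := hMn m hmM; omega⟩
      have hlate : Late M τ p := by
        refine ⟨fun h => ?_, fun h => ?_⟩
        · have := hmax p h; have := hτ p h hmM; omega
        · have := hmax _ h; have h2 : τ (p + 1) ≠ τ (p + 2) := hτ (p + 1) hmM h; omega
      have hdiff := late_diff hY p hmM hlate
      have hYz : yv (eZ n lam) (eZ n a) (p + 1) = 0 := by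
        have e1 := eq_of_yv (eZ n lam) (eZ n a) p
        have e2 := eq_of_yv (eZ n lam) (eZ n a) (p + 1)
        rw [show p + 1 + 1 = p + 2 from rfl] at e2
        have hn := hY.nonneg hl h0 (p + 1)
        have hpn := hMn _ hmM
        have : eZ n a (p + 1) ≤ eZ n a p := by
          unfold eZ
          by_contra hc
          exact hasc ⟨⟨p, by omega⟩, by simpa using hc⟩
        linarith
      have hG' := ((goodY_erase hmM hlate).1 hY).1
      rw [← hYz, Function.update_eq_self] at hG'
      obtain ⟨ih1, ih2⟩ := ih (k + 1) (M.erase (p + 1)) a (hcard _ hmM) (by omega) (hMne _) (hτe _) hG'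
      have h0e : 0 ∉ M.erase (p + 1) := fun h => h0 (Finset.mem_of_mem_erase h)
      refine ⟨ih1, fun b => ?_⟩
      rw [ih2]
      constructor
      · intro h
        have hz := h.1 (p + 1) (by simp)
        rw [inS_erase hmM hlate]
        have hu : Function.update (yv (eZ n lam) (eZ n b)) (p + 1) 0 = yv (eZ n lam) (eZ n b) := by
          rw [← hz, Function.update_eq_self]
        rw [hu, hz]
        refine ⟨h, fun m hm => h.1 m (fun h2 => hm (Finset.mem_of_mem_erase h2)), le_rfl, ?_⟩
        have n1 := h.nonneg h0e p
        have n2 := h.nonneg h0e (p + 2)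
        have hlp := hl (Nat.le_succ p)
        simp only [Nat.succ_eq_add_one] at hlp
        linarith
      · intro h
        have h1 := h.le h0 hY (p + 1)
        have h2 := h.nonneg h0 (p + 1)
        have hz : yv (eZ n lam) (eZ n b) (p + 1) = 0 := by linarith
        have := ((inS_erase hmM hlate).1 h).1
        rwa [← hz, Function.update_eq_self] at this

end LSS

open scoped Classical
namespace LSS
open MvPolynomial

/-- extension by zero of an integer vector -/
def extZ (n : ℕ) (v : Fin n → ℤ) (r : ℕ) : ℤ := if h : r < n then v ⟨r, h⟩ else 0

theorem extZ_fin (n : ℕ) (v : Fin n → ℤ) (p : Fin n) : extZ n v p.1 = v p := by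
  unfold extZ; rw [dif_pos p.2]

theorem extZ_out (n : ℕ) (v : Fin n → ℤ) (r : ℕ) (h : n ≤ r) : extZ n v r = 0 := by
  unfold extZ; rw [dif_neg (by omega)]

theorem eZ_toNatV (n : ℕ) (v : Fin n → ℤ) (hv : ∀ p, 0 ≤ v p) : eZ n (toNatV n v) = extZ n v := by
  funext r
  by_cases h : r < n
  · have e1 := eZ_fin n (toNatV n v) ⟨r, h⟩
    have e2 := extZ_fin n v ⟨r, h⟩
    have := hv ⟨r, h⟩
    simp only [toNatV] at e1
    rw [e2]
    rw [e1]; omega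
  · rw [eZ_out _ _ _ (by omega), extZ_out _ _ _ (by omega)]

theorem psumZ_eq (n : ℕ) (v : Fin n → ℤ) (m : ℕ) :
    psumZ n v m = ∑ r ∈ Finset.range (m + 1), extZ n v r := by
  unfold psumZ
  rw [Finset.sum_filter]
  have h1 : ∀ p : Fin n, (if p.1 ≤ m then v p else 0) = (fun r => if r ≤ m then extZ n v r else 0) p.1 := by
    intro p; simp only [extZ_fin]
  rw [Finset.sum_congr rfl (fun p _ => h1 p), Fin.sum_univ_eq_sum_range
    (fun r => if r ≤ m then extZ n v r else 0) n, ← Finset.sum_filter]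
  refine Finset.sum_subset ?_ ?_
  · intro r hr
    simp at hr ⊢; omega
  · intro r hr hr2
    simp at hr hr2
    apply extZ_out
    by_contra hc
    have := hr2 (by omega)
    omega

theorem psumN_eq (n : ℕ) (a : Fin n → ℕ) (m : ℕ) :
    psumN n a m = ∑ r ∈ Finset.range (m + 1), eZ n a r := by
  have h := psumZ_eq n (fun p => (a p : ℤ)) m
  have e : extZ n (fun p => (a p : ℤ)) = eZ n a := by
    funext r
    by_cases h : r < n
    · rw [extZ_fin n _ ⟨r, h⟩, eZ_fin n _ ⟨r, h⟩]
    · rw [eZ_out _ _ _ (by omega), extZ_out _ _ _ (by omega)]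
  rw [e] at h
  exact h

theorem yv_addI (l b b' : ℕ → ℤ) (i j : ℕ) (hij : i < j) (N : ℤ) (hi : b' i = b i - N)
    (hj : b' j = b j + N) (ho : ∀ r, r ≠ i → r ≠ j → b' r = b r) :
    yv l b' = addI (yv l b) i j N := by
  funext m
  unfold addI
  induction m with
  | zero => simp [yv]
  | succ m ih =>
    rw [yv_succ, yv_succ, ih]
    by_cases h1 : m = i
    · subst h1
      rw [hi, if_neg (by omega), if_pos (by omega)]; ring
    · by_cases h2 : m = j
      · subst h2
        rw [hj, if_pos (by omega), if_neg (by omega)]; ring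
      · rw [ho m h1 h2]
        by_cases h3 : i < m ∧ m ≤ j
        · rw [if_pos h3, if_pos (by omega)]; ring
        · rw [if_neg h3, if_neg (by omega)]; ring

theorem no_late {n : ℕ} (W : List ℕ) (hnd : W.Nodup) (hv : ∀ i ∈ W, 1 ≤ i ∧ i ≤ n - 1) (p : ℕ)
    (hp : p + 1 ∈ W.toFinset) (hL : Late W.toFinset (tauL W) p) :
    len n (st n (p + 1) * (W.map (st n)).prod) < len n (W.map (st n)).prod := by
  have hm : 0 < p + 1 ∧ p + 1 < n := by
    have := hv (p + 1) (by simpa using hp); omega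
  have hG := good_of_word n (fun q => n - 1 - q.1) W hnd hv
  have hpart : IsPartition n (fun q => n - 1 - q.1) := by
    intro a b hab
    have := Fin.le_def.1 hab
    show n - 1 - b.1 ≤ n - 1 - a.1
    omega
  have hl := eZ_antitone hpart
  have h0 : 0 ∉ W.toFinset := fun h => by have := hv 0 (by simpa using h); omega
  have hn := hG.nonneg hl h0
  have hdiff := late_diff hG p hp hL
  have hval := ((goodY_erase hp hL).1 hG).2.2
  have l0 := eZ_fin n (fun q => n - 1 - q.1) ⟨p, by omega⟩
  have l1 := eZ_fin n (fun q => n - 1 - q.1) ⟨p + 1, hm.2⟩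
  have e1 := eq_of_yv (eZ n (fun q => n - 1 - q.1))
    (eZ n (pact n (W.map (st n)).prod (fun q => n - 1 - q.1))) p
  have e2 := eq_of_yv (eZ n (fun q => n - 1 - q.1))
    (eZ n (pact n (W.map (st n)).prod (fun q => n - 1 - q.1))) (p + 1)
  have a0 := eZ_fin n (pact n (W.map (st n)).prod (fun q => n - 1 - q.1)) ⟨p, by omega⟩
  have a1 := eZ_fin n (pact n (W.map (st n)).prod (fun q => n - 1 - q.1)) ⟨p + 1, hm.2⟩
  rw [show p + 1 + 1 = p + 2 from rfl] at e2
  have n1 := hn p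
  have n2 := hn (p + 2)
  simp only [pact] at l0 l1 a0 a1
  rw [desc_iff hm]
  have key : eZ n (pact n (W.map (st n)).prod (fun q => n - 1 - q.1)) p <
      eZ n (pact n (W.map (st n)).prod (fun q => n - 1 - q.1)) (p + 1) := by
    have : (((n - 1 - (p + 1) : ℕ)) : ℤ) < ((n - 1 - p : ℕ) : ℤ) := by omega
    linarith
  rw [a0, a1] at key
  rw [Fin.lt_def]
  simp only [Nat.add_sub_cancel]
  omega

/-- the main theorem, before abstracting the Coxeter element -/
theorem main_aux (n k : ℕ) (d : Fin (k + 2) → ℕ) (hd : BlockData n k d)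
    (W : List ℕ) (hnd : W.Nodup) (hv : ∀ i ∈ W, 1 ≤ i ∧ i ≤ n - 1)
    (c w0I : Equiv.Perm (Fin n)) (hc : (W.map (st n)).prod = c)
    (h0 : IsLongest n (Iset n k d) w0I)
    (hlen : len n (w0I * c) = len n w0I + len n c)
    (lam : Fin n → ℕ) (hlam : IsPartition n lam)
    (γ : Fin (k + 1) → ℕ → ℕ)
    (β : Fin n → ℤ) (hβ : memP n k d w0I (pact n c lam) γ β)
    (i j : Fin n) (hij : i < j) (hsb : SameBlock n k d i j)
    (hgt : β j - gapZ n i j < β i) :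
    memP n k d w0I (pact n c lam) γ (tmv n i j β) ↔
      ((leftmin n (pact n c lam) i : ℤ) ≤ β j - gapZ n i j ∧
       β i + gapZ n i j ≤ (rightmax n (pact n c lam) j : ℤ) ∧
       (Interweaved n (pact n c lam) i j →
         psumN n (pact n c lam) (center n (pact n c lam) i j) ≤
           psumZ n (tmv n i j β) (center n (pact n c lam) i j))) := by
  have hijN := Fin.lt_def.1 hij
  have hl := eZ_antitone hlam
  have hI := block_I hd i j hsb
  have hM0 : 0 ∉ W.toFinset := fun h => by have := hv 0 (by simpa using h); omega
  have hMn : ∀ m ∈ W.toFinset, 1 ≤ m ∧ m ≤ n - 1 := fun m h => hv m (by simpa using h)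
  have hτ : ∀ p, p ∈ W.toFinset → p + 1 ∈ W.toFinset → tauL W p ≠ tauL W (p + 1) := fun p h1 h2 =>
    tauL_ne W p (p + 1) (by simpa using h1) (by simpa using h2) (by omega)
  have hY := good_of_word n lam W hnd hv
  rw [hc] at hY
  have hnodesc : ∀ m ∈ Iset n k d, ¬ len n (st n m * c) < len n c := by
    intro m hm hlt
    have hm' : 0 < m ∧ m < n := by have := hm.1; have := hm.2.1; omega
    have h1 := longest_mul_st hm' hm h0
    have h2 := len_mul_le n (w0I * st n m) (st n m * c)
    have h3 : w0I * st n m * (st n m * c) = w0I * c := by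
      rw [mul_assoc, st_mul_st_mul]
    rw [h3] at h2
    omega
  have hnl : ∀ p, i.1 ≤ p → p < j.1 → p + 1 ∈ W.toFinset → ¬ Late W.toFinset (tauL W) p := by
    intro p h1 h2 h3 h4
    have := no_late W hnd hv p h3 h4
    rw [hc] at this
    exact hnodesc (p + 1) (hI _ (by omega) (by omega)) this
  have hb : ∀ p, i.1 ≤ p → p < j.1 → p + 1 ∈ W.toFinset →
      (p + 2 ∈ W.toFinset ∧ tauL W (p + 1) < tauL W (p + 2)) ∨
      (p ∈ W.toFinset ∧ tauL W (p + 1) < tauL W p) := by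
    intro p h1 h2 h3
    by_contra hcon
    rw [not_or, not_and, not_and] at hcon
    apply hnl p h1 h2 h3
    refine ⟨fun h => ?_, fun h => ?_⟩
    · have := hcon.2 h; have := hτ p h h3; omega
    · have := hcon.1 h
      have h5 : tauL W (p + 1) ≠ tauL W (p + 2) := hτ (p + 1) h3 h
      omega
  set α := pact n c lam with hαdef
  have hdec : ∀ p, i.1 ≤ p → p < j.1 → eZ n α (p + 1) ≤ eZ n α p := by
    intro p h1 h2
    by_contra hcon
    push Not at hcon
    have e1 := eq_of_yv (eZ n lam) (eZ n α) p
    have e2 := eq_of_yv (eZ n lam) (eZ n α) (p + 1)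
    rw [show p + 1 + 1 = p + 2 from rfl] at e2
    obtain ⟨h3, h4⟩ := asc_late hl hM0 hτ hY p (by rw [← e1, ← e2]; exact hcon)
    exact hnl p h1 h2 h3 h4
  have hcard : W.toFinset.card ≤ n * n := by
    have h1 : W.toFinset ⊆ Finset.range n := by
      intro m hm
      have := hMn m hm
      rw [Finset.mem_range]; omega
    have h2 := Finset.card_le_card h1
    rw [Finset.card_range] at h2
    exact h2.trans (Nat.le_mul_self n)
  have hsupp := (key_support n lam hlam (tauL W) _ (n * n) W.toFinset α rfl hcard hMn hτ hY).2
  obtain ⟨hβ0, hβc, L, hL, hβs⟩ := hβ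
  unfold keyPoly at hβc
  rw [hsupp, eZ_toNatV n β hβ0] at hβc
  have hg : gapZ n i j = (j.1 : ℤ) - i.1 := rfl
  have hne : j ≠ i := fun h => by rw [h] at hij; exact lt_irrefl _ hij
  have hti : tmv n i j β i = β j - gapZ n i j := by simp [tmv]
  have htj : tmv n i j β j = β i + gapZ n i j := by simp [tmv, hne]
  have hto : ∀ p, p ≠ i → p ≠ j → tmv n i j β p = β p := by
    intro p h1 h2; simp [tmv, h1, h2]
  have hyt : yv (eZ n lam) (extZ n (tmv n i j β)) =
      addI (yv (eZ n lam) (extZ n β)) i.1 j.1 (β i - β j + ((j.1 : ℤ) - i.1)) := by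
    apply yv_addI _ _ _ _ _ hijN
    · rw [extZ_fin, extZ_fin, hti, hg]; ring
    · rw [extZ_fin, extZ_fin, htj, hg]; ring
    · intro r h1 h2
      by_cases hr : r < n
      · rw [extZ_fin n _ ⟨r, hr⟩, extZ_fin n _ ⟨r, hr⟩]
        exact hto _ (fun h => h1 (congrArg Fin.val h)) (fun h => h2 (congrArg Fin.val h))
      · rw [extZ_out _ _ _ (by omega), extZ_out _ _ _ (by omega)]
  have hLne : (α '' {q | q ≤ i}).Nonempty := ⟨α i, i, le_refl i, rfl⟩
  have hcore := core hl hM0 hτ hY hβc i.1 j.1 hijN hb (eZ n α) (extZ n β)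
    (fun p => eq_of_yv _ _ p) (fun p => eq_of_yv _ _ p)
    (β i - β j + ((j.1 : ℤ) - i.1)) (by rw [hg] at hgt; linarith)
    (by rw [extZ_fin, extZ_fin]) (leftmin n α i : ℤ) (rightmax n α j : ℤ)
    (by
      intro r hr
      have hrn : r < n := by have := i.2; omega
      rw [eZ_fin n α ⟨r, hrn⟩]
      have : leftmin n α i ≤ α ⟨r, hrn⟩ := Nat.sInf_le ⟨⟨r, hrn⟩, Fin.le_def.2 hr, rfl⟩
      exact_mod_cast this)
    (by
      obtain ⟨q, hq, he⟩ := Nat.sInf_mem hLne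
      refine ⟨q.1, Fin.le_def.1 hq, ?_⟩
      rw [eZ_fin]
      exact_mod_cast he)
    (by
      intro r hr
      by_cases hrn : r < n
      · rw [eZ_fin n α ⟨r, hrn⟩]
        have hmem : (⟨r, hrn⟩ : Fin n) ∈ Finset.univ.filter (fun q : Fin n => j ≤ q) :=
          Finset.mem_filter.2 ⟨Finset.mem_univ _, Fin.le_def.2 hr⟩
        have : α ⟨r, hrn⟩ ≤ rightmax n α j := by
          unfold rightmax
          exact Finset.le_sup (f := α) hmem
        exact_mod_cast this
      · rw [eZ_out _ _ _ (by omega)]; positivity)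
    (by
      obtain ⟨q, hq, he⟩ := Finset.exists_mem_eq_sup (Finset.univ.filter fun q : Fin n => j ≤ q)
        ⟨j, Finset.mem_filter.2 ⟨Finset.mem_univ _, le_refl j⟩⟩ α
      refine ⟨q.1, Fin.le_def.1 (Finset.mem_filter.1 hq).2, ?_⟩
      rw [eZ_fin]
      exact_mod_cast he.symm)
    (center n α i j)
    (by
      intro q h1 h2 h3 h4
      have hqn : q < n := by have := j.2; omega
      unfold center
      apply le_antisymm
      · apply Finset.sup_le
        intro p hp
        simp only [Finset.mem_filter, Finset.mem_univ, true_and] at hp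
        by_contra hcon
        have h5 := h4 p.1 (by omega) (Fin.le_def.1 hp.2.1)
        rw [eZ_fin] at h5
        have h6 : ((rightmax n α j : ℕ) : ℤ) ≤ α p := by exact_mod_cast hp.2.2
        omega
      · refine Finset.le_sup (f := fun p : Fin n => p.1) (b := ⟨q, hqn⟩) ?_
        simp only [Finset.mem_filter, Finset.mem_univ, true_and]
        rw [eZ_fin n α ⟨q, hqn⟩] at h3
        exact ⟨Fin.le_def.2 h1, Fin.le_def.2 h2, by exact_mod_cast h3⟩)
  rw [← hyt] at hcore
  have hiw : Interweaved n α i j ↔ ((leftmin n α i : ℤ) < eZ n α i.1 ∧ eZ n α j.1 < (rightmax n α j : ℤ)) := by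
    rw [eZ_fin, eZ_fin]
    unfold Interweaved
    constructor
    · rintro ⟨-, -, h1, h2⟩
      exact ⟨by exact_mod_cast h1, by exact_mod_cast h2⟩
    · rintro ⟨h1, h2⟩
      refine ⟨hij, ?_, by exact_mod_cast h1, by exact_mod_cast h2⟩
      intro p h3 h4
      have h5 := hdec p.1 (Fin.le_def.1 h3) (Fin.lt_def.1 h4)
      rw [eZ_fin] at h5
      unfold eZ at h5
      exact_mod_cast h5
  have hps : ∀ m, psumN n α m ≤ psumZ n (tmv n i j β) m ↔
      yv (eZ n lam) (extZ n (tmv n i j β)) (m + 1) ≤ yv (eZ n lam) (eZ n α) (m + 1) := by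
    intro m
    rw [psumN_eq, psumZ_eq]
    unfold yv
    rw [Finset.sum_sub_distrib, Finset.sum_sub_distrib]
    constructor <;> intro h <;> linarith
  have hcond : InS W.toFinset (tauL W) (eZ n lam) (yv (eZ n lam) (extZ n (tmv n i j β))) ↔
      ((leftmin n α i : ℤ) ≤ β j - gapZ n i j ∧ β i + gapZ n i j ≤ (rightmax n α j : ℤ) ∧
       (Interweaved n α i j → psumN n α (center n α i j) ≤ psumZ n (tmv n i j β) (center n α i j))) := by
    rw [hcore, hiw, hps, extZ_fin, extZ_fin, hg]
    have q1 : β i - (β i - β j + ((j.1 : ℤ) - i.1)) = β j - ((j.1 : ℤ) - i.1) := by ring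
    have q2 : β j + (β i - β j + ((j.1 : ℤ) - i.1)) = β i + ((j.1 : ℤ) - i.1) := by ring
    rw [q1, q2, and_imp]
  rw [← hcond]
  constructor
  · rintro ⟨h1, h2, -⟩
    unfold keyPoly at h2
    rw [hsupp, eZ_toNatV n _ h1] at h2
    exact h2
  · intro h
    have hnn : ∀ p, 0 ≤ tmv n i j β p := by
      intro p
      have h1 := (hcond.1 h).1
      by_cases hp : p = i
      · subst hp; rw [hti]; exact le_trans (by positivity) h1
      · by_cases hp2 : p = j
        · subst hp2; rw [htj, hg]
          have := hβ0 i
          omega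
        · rw [hto p hp hp2]; exact hβ0 p
    refine ⟨hnn, ?_, L, hL, ?_⟩
    · unfold keyPoly
      rw [hsupp, eZ_toNatV n _ hnn]
      exact h
    · rw [flip_t hd h0 hL i j hij hI β hβ0 hnn]
      rcases hβs with h1 | h1
      · right; rw [h1]
      · left; rw [h1, neg_neg]

end LSS

namespace LSS

/-- Proposition 6.8: for `β ∈ P_{cλ,γ}` and `i < j` in the same block
with `β_i > β_j − (j−i)`, `t_{ij}β ∈ P_{cλ,γ}` iff conditions (1), (2), (3) hold. -/
theorem stmt17 (n k : ℕ) (d : Fin (k + 2) → ℕ) (hd : BlockData n k d)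
    (c w0I : Equiv.Perm (Fin n)) (hc : IsStdCox n c)
    (h0 : IsLongest n (Iset n k d) w0I)
    (hlen : len n (w0I * c) = len n w0I + len n c)
    (hJ : Iset n k d ⊆ Descents n (w0I * c))
    (lam : Fin n → ℕ) (hlam : IsPartition n lam)
    (γ : Fin (k + 1) → ℕ → ℕ) (hγ : ParD k d γ)
    (β : Fin n → ℤ) (hβ : memP n k d w0I (pact n c lam) γ β)
    (i j : Fin n) (hij : i < j) (hsb : SameBlock n k d i j)
    (hgt : β j - gapZ n i j < β i) :
    memP n k d w0I (pact n c lam) γ (tmv n i j β) ↔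
      ((leftmin n (pact n c lam) i : ℤ) ≤ β j - gapZ n i j ∧
       β i + gapZ n i j ≤ (rightmax n (pact n c lam) j : ℤ) ∧
       (Interweaved n (pact n c lam) i j →
         psumN n (pact n c lam) (center n (pact n c lam) i j) ≤
           psumZ n (tmv n i j β) (center n (pact n c lam) i j))) := by
  obtain ⟨W, hnd, hv, hW⟩ := hc
  exact main_aux n k d hd W hnd hv c w0I hW h0 hlen lam hlam γ β hβ i j hij hsb hgt

end LSS
end

section
/- Fix D = {d_1 < … < d_k} ⊆ [n−1] with d_0 = 0, d_{k+1} = n and I = [n−1] ∖ D; let c ∈ S_n be a standard Coxeter element of some parabolic subgroup with ℓ(w_0(I)c) = ℓ(w_0(I)) + ℓ(c), and let λ be a partition with at most n parts. Let i ∈ [n−1] and let β be a weak composition with [x^β]κ_{cλ} ≠ 0. Then max{rightmax_{cλ}(i+1) − leftmin_{cλ}(i), 0} ≥ β_1 + ⋯ + β_i − ((cλ)_1 + ⋯ + (cλ)_i). -/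
open scoped Classical

namespace LSS

section Helpers

open MvPolynomial

/-- Prefix sum bound. -/
def bnd (n : ℕ) (lam : Fin n → ℕ) (m : ℕ) : ℕ :=
  ∑ p ∈ Finset.univ.filter (fun p : Fin n => p.1 < m), lam p

theorem card_prefix (n m : ℕ) (h : m ≤ n) :
    (Finset.univ.filter (fun p : Fin n => p.1 < m)).card = m := by
  rw [Fin.card_filter_val_lt]; omega

theorem sum_le_bnd (n : ℕ) (lam : Fin n → ℕ) (hlam : IsPartition n lam) (T : Finset (Fin n)) :
    ∑ p ∈ T, lam p ≤ bnd n lam T.card := by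
  unfold bnd
  set P := Finset.univ.filter (fun p : Fin n => p.1 < T.card) with hP
  have hT : T.card ≤ n := by simpa using Finset.card_le_univ T
  have hPc : P.card = T.card := card_prefix n _ hT
  have hcard : (T \ P).card = (P \ T).card := Finset.card_sdiff_comm hPc.symm
  rw [← Finset.sum_inter_add_sum_sdiff T P, ← Finset.sum_inter_add_sum_sdiff P T,
    Finset.inter_comm P T]
  refine Nat.add_le_add_left ?_ _
  rcases Nat.eq_zero_or_pos T.card with h0 | h0
  · have : T = ∅ := Finset.card_eq_zero.mp h0
    simp [this]
  · have hk : T.card - 1 < n := by omega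
    have h1 : ∑ p ∈ T \ P, lam p ≤ (T \ P).card • lam ⟨T.card - 1, hk⟩ := by
      apply Finset.sum_le_card_nsmul
      intro x hx
      apply hlam
      simp [hP] at hx
      rw [Fin.le_def]; simp only; omega
    have h2 : (P \ T).card • lam ⟨T.card - 1, hk⟩ ≤ ∑ p ∈ P \ T, lam p := by
      apply Finset.card_nsmul_le_sum
      intro x hx
      apply hlam
      simp [hP] at hx
      rw [Fin.le_def]; simp only; omega
    rw [hcard] at h1
    exact h1.trans h2

/-- Grading map: variables in `S` get multiplied by the new variable. -/
noncomputable def phi (n : ℕ) (S : Finset (Fin n)) :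
    MvPolynomial (Fin n) ℤ →ₐ[ℤ] Polynomial (MvPolynomial (Fin n) ℤ) :=
  aeval (fun j => Polynomial.C (X j) * Polynomial.X ^ (if j ∈ S then 1 else 0))

theorem phi_X (n : ℕ) (S : Finset (Fin n)) (j : Fin n) :
    phi n S (X j) = Polynomial.C (X j) * Polynomial.X ^ (if j ∈ S then 1 else 0) := by
  simp [phi]

theorem phi_monomial (n : ℕ) (S : Finset (Fin n)) (d : Fin n →₀ ℕ) (a : ℤ) :
    phi n S (monomial d a) =
      Polynomial.C (monomial d a) * Polynomial.X ^ (∑ p ∈ S, d p) := by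
  have h1 : (monomial d a : MvPolynomial (Fin n) ℤ) = C a * ∏ j, X j ^ d j := by
    rw [MvPolynomial.monomial_eq, Finsupp.prod_fintype]
    intro i; simp
  rw [h1, map_mul, map_prod]
  simp only [map_pow, phi_X, mul_pow, Finset.prod_mul_distrib, ← pow_mul]
  rw [Finset.prod_pow_eq_pow_sum]
  have h2 : ∑ j, (if j ∈ S then 1 else 0) * d j = ∑ p ∈ S, d p := by
    simp
  have h3 : phi n S (C a) = Polynomial.C (C a) := by
    rw [← MvPolynomial.algebraMap_eq, AlgHom.commutes]; simp
  rw [h2, h3]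
  simp only [map_mul, map_prod, map_pow, mul_assoc]

theorem coeff_phi (n : ℕ) (S : Finset (Fin n)) (f : MvPolynomial (Fin n) ℤ) (d : Fin n →₀ ℕ) :
    coeff d ((phi n S f).coeff (∑ p ∈ S, d p)) = coeff d f := by
  induction f using MvPolynomial.induction_on' with
  | monomial u a =>
    rw [phi_monomial, Polynomial.coeff_C_mul, Polynomial.coeff_X_pow, coeff_monomial]
    by_cases h : u = d
    · subst h; simp
    · split_ifs <;> simp [coeff_monomial, h]
  | add p q hp hq => simp [hp, hq]

/-- All `S`-degrees of `f` are bounded by prefix sums. -/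
def Good (n : ℕ) (lam : Fin n → ℕ) (f : MvPolynomial (Fin n) ℤ) : Prop :=
  ∀ S : Finset (Fin n), (phi n S f).natDegree ≤ bnd n lam S.card

theorem phi_rename (n : ℕ) (S : Finset (Fin n)) (e : Equiv.Perm (Fin n))
    (f : MvPolynomial (Fin n) ℤ) :
    phi n S (rename e f) =
      (phi n (S.map e.symm.toEmbedding) f).map (rename e : _ →ₐ[ℤ] _).toRingHom := by
  induction f using MvPolynomial.induction_on' with
  | monomial u a =>
    rw [rename_monomial, phi_monomial, phi_monomial]
    have : ∑ p ∈ S, (Finsupp.mapDomain e u) p = ∑ p ∈ S.map e.symm.toEmbedding, u p := by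
      rw [Finset.sum_map]
      refine Finset.sum_congr rfl fun p _ => ?_
      rw [← Finsupp.equivMapDomain_eq_mapDomain]; simp
    simp [this, rename_monomial]
  | add p q hp hq => simp only [map_add, hp, hq, Polynomial.map_add]

theorem good_dem (n : ℕ) (lam : Fin n → ℕ) (i : ℕ) (f : MvPolynomial (Fin n) ℤ)
    (hf : Good n lam f) : Good n lam (dem n i f) := by
  unfold dem
  split_ifs with h hg
  · have hs := hg.choose_spec
    generalize hg.choose = g at hs
    set a : Fin n := ⟨i - 1, by omega⟩ with ha
    set b : Fin n := ⟨i, h.2⟩ with hb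
    have hab : a ≠ b := by simp [ha, hb, Fin.ext_iff]; omega
    intro S
    have h2 := congrArg (phi n S) hs
    rw [map_mul, map_sub, map_sub, map_mul, map_mul, phi_rename] at h2
    set F := phi n S f
    set F' := (phi n (S.map (Equiv.swap a b).symm.toEmbedding) f).map
      (rename (Equiv.swap a b) : _ →ₐ[ℤ] _).toRingHom with hF'
    have d1 : F.natDegree ≤ bnd n lam S.card := hf S
    have d2 : F'.natDegree ≤ bnd n lam S.card := by
      refine Polynomial.natDegree_map_le.trans ?_
      simpa using hf (S.map (Equiv.swap a b).symm.toEmbedding)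
    set m := bnd n lam S.card
    by_cases hg0 : phi n S g = 0
    · rw [hg0]; simp
    have hXX : (X a - X b : MvPolynomial (Fin n) ℤ) ≠ 0 := by
      rw [sub_ne_zero]
      exact fun h => hab (MvPolynomial.X_injective h)
    have key : ∀ (Q : Polynomial (MvPolynomial (Fin n) ℤ)) (t : ℕ), Q ≠ 0 → t ≤ Q.natDegree →
        (Q * phi n S g).natDegree ≤ t + m → (phi n S g).natDegree ≤ m := by
      intro Q t hQ ht hh
      rw [Polynomial.natDegree_mul hQ hg0] at hh
      omega
    have dX : ∀ j, (phi n S (X j)).natDegree ≤ if j ∈ S then 1 else 0 := by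
      intro j
      rw [phi_X]
      exact Polynomial.natDegree_C_mul_X_pow_le _ _
    have dR : ∀ t, (phi n S (X a)).natDegree ≤ t → (phi n S (X b)).natDegree ≤ t →
        (phi n S (X a) * F - phi n S (X b) * F').natDegree ≤ t + m := by
      intro t h3 h4
      refine (Polynomial.natDegree_sub_le _ _).trans (max_le ?_ ?_)
      · exact Polynomial.natDegree_mul_le.trans (by omega)
      · exact Polynomial.natDegree_mul_le.trans (by omega)
    have hQ0 : phi n S (X a) - phi n S (X b) ≠ 0 := by
      rw [← map_sub]
      intro h5
      apply hXX
      ext d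
      rw [← coeff_phi n S, h5]; simp
    by_cases hS : a ∈ S ∨ b ∈ S
    · refine key _ 1 hQ0 ?_ ?_
      · apply Polynomial.le_natDegree_of_ne_zero
        rw [phi_X, phi_X, Polynomial.coeff_sub, Polynomial.coeff_C_mul, Polynomial.coeff_C_mul,
          Polynomial.coeff_X_pow, Polynomial.coeff_X_pow]
        by_cases h6 : a ∈ S <;> by_cases h7 : b ∈ S
        · simpa [h6, h7] using hXX
        · simp [h6, h7]
        · simp [h6, h7]
        · tauto
      · rw [h2]
        exact dR 1 ((dX a).trans (by split_ifs <;> simp)) ((dX b).trans (by split_ifs <;> simp))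
    · push Not at hS
      refine key _ 0 hQ0 (Nat.zero_le _) ?_
      rw [h2]
      exact dR 0 ((dX a).trans (by simp [hS.1])) ((dX b).trans (by simp [hS.2]))
  · intro S; simp
  · exact hf

theorem good_mono (n : ℕ) (lam : Fin n → ℕ) (hlam : IsPartition n lam)
    (e : Equiv.Perm (Fin n)) : Good n lam (mono n (fun p => lam (e p))) := by
  intro S
  unfold mono
  rw [phi_monomial]
  refine (Polynomial.natDegree_C_mul_X_pow_le _ _).trans ?_
  have := sum_le_bnd n lam hlam (S.map e.toEmbedding)
  simpa [expOf] using this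

theorem good_key (n : ℕ) (lam : Fin n → ℕ) (hlam : IsPartition n lam) (k : ℕ) :
    ∀ e : Equiv.Perm (Fin n), Good n lam (keyAux n k (fun p => lam (e p))) := by
  induction k with
  | zero => intro e; exact good_mono n lam hlam e
  | succ k ih =>
    intro e
    unfold keyAux
    split_ifs with h
    · apply good_dem
      have hp := h.choose_spec
      generalize h.choose = p at hp
      have hpn : p.1 + 1 < n := by
        by_contra hcon
        simp [ent, hcon] at hp
      have : swapAt n p.1 (fun q => lam (e q)) =
          fun q => lam ((e * Equiv.swap p ⟨p.1 + 1, hpn⟩) q) := by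
        funext m
        unfold swapAt ent
        simp only [Equiv.Perm.mul_apply, hpn, p.2, dite_true]
        by_cases h1 : m = p
        · subst h1; simp
        by_cases h2 : m = ⟨p.1 + 1, hpn⟩
        · subst h2; simp
        · rw [Equiv.swap_apply_of_ne_of_ne h1 h2]
          rw [if_neg (fun h => h1 (Fin.ext h)), if_neg (fun h => h2 (Fin.ext h))]
      rw [this]
      exact ih _
    · exact good_mono n lam hlam e

theorem st_pres (n i j : ℕ) (hij : j ≠ i) (p : Fin n) : (st n j p).1 < i ↔ p.1 < i := by
  unfold st
  split_ifs with h
  · rw [Equiv.swap_apply_def]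
    split_ifs with h1 h2
    · subst h1; simp only; omega
    · subst h2; simp only; omega
    · rfl
  · rfl

theorem prod_pres (n i : ℕ) (L : List ℕ) (hL : i ∉ L) (p : Fin n) :
    ((L.map (st n)).prod p).1 < i ↔ p.1 < i := by
  induction L with
  | nil => simp
  | cons j L ih =>
    simp only [List.mem_cons, not_or] at hL
    rw [List.map_cons, List.prod_cons, Equiv.Perm.mul_apply, st_pres n i j (Ne.symm hL.1), ih hL.2]

theorem sum_pres (n i : ℕ) (u : Equiv.Perm (Fin n)) (hu : ∀ p, (u p).1 < i ↔ p.1 < i)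
    (g : Fin n → ℕ) :
    ∑ p ∈ Finset.univ.filter (fun p : Fin n => p.1 < i), g (u⁻¹ p) =
      ∑ p ∈ Finset.univ.filter (fun p : Fin n => p.1 < i), g p := by
  symm
  apply Finset.sum_equiv u
  · intro p; simp [hu]
  · intro p _; simp

theorem cox_bound (n : ℕ) (c : Equiv.Perm (Fin n)) (hc : IsStdCox n c) (lam : Fin n → ℕ)
    (i : ℕ) (hi1 : 1 ≤ i) (hi : i < n) :
    (bnd n lam i : ℤ) - bnd n (pact n c lam) i ≤
      max ((rightmax n (pact n c lam) ⟨i, hi⟩ : ℤ) -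
        (leftmin n (pact n c lam) ⟨i - 1, by omega⟩ : ℤ)) 0 := by
  obtain ⟨L, hnd, -, rfl⟩ := hc
  by_cases hiL : i ∈ L
  · obtain ⟨L1, L2, rfl⟩ := List.append_of_mem hiL
    rw [List.nodup_append] at hnd
    have hi1L : i ∉ L1 := fun h => hnd.2.2 i h i (by simp) rfl
    have hi2L : i ∉ L2 := (List.nodup_cons.mp hnd.2.1).1
    have hu := prod_pres n i L1 hi1L
    have hv := prod_pres n i L2 hi2L
    rw [List.map_append, List.map_cons, List.prod_append, List.prod_cons]
    generalize (L1.map (st n)).prod = u at *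
    generalize (L2.map (st n)).prod = v at *
    set a : Fin n := ⟨i - 1, by omega⟩ with ha
    set b : Fin n := ⟨i, hi⟩ with hb
    have hst : st n i = Equiv.swap a b := by
      unfold st; rw [dif_pos ⟨by omega, hi⟩]
    rw [hst]
    set α := pact n (u * (Equiv.swap a b * v)) lam with hα
    have hαv : ∀ q, α (u (Equiv.swap a b (v q))) = lam q := by
      intro q; simp [hα, pact]
    have e1 : bnd n α i = ∑ p ∈ Finset.univ.filter (fun p : Fin n => p.1 < i),
        lam (v⁻¹ (Equiv.swap a b p)) := by
      rw [← sum_pres n i u hu]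
      unfold bnd
      refine Finset.sum_congr rfl fun p _ => ?_
      simp [hα, pact]
    have e2 : bnd n lam i = ∑ p ∈ Finset.univ.filter (fun p : Fin n => p.1 < i),
        lam (v⁻¹ p) := (sum_pres n i v hv lam).symm
    have hamem : a ∈ Finset.univ.filter (fun p : Fin n => p.1 < i) := by
      simp [ha]; omega
    rw [← Finset.add_sum_erase _ _ hamem] at e1 e2
    have e3 : ∑ p ∈ (Finset.univ.filter (fun p : Fin n => p.1 < i)).erase a,
        lam (v⁻¹ (Equiv.swap a b p)) =
        ∑ p ∈ (Finset.univ.filter (fun p : Fin n => p.1 < i)).erase a, lam (v⁻¹ p) := by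
      refine Finset.sum_congr rfl fun p hp => ?_
      rw [Equiv.swap_apply_of_ne_of_ne]
      · exact Finset.ne_of_mem_erase hp
      · rintro rfl
        simp [hb] at hp
    rw [e3, Equiv.swap_apply_left] at e1
    have r1 : lam (v⁻¹ a) ≤ rightmax n α b := by
      rw [← hαv]
      apply Finset.le_sup (f := α)
      have := hu b
      simp [hb] at this
      simp [Fin.le_def, hb]
      exact this
    have r2 : leftmin n α a ≤ lam (v⁻¹ b) := by
      rw [← hαv]
      apply Nat.sInf_le
      refine ⟨_, ?_, rfl⟩
      have := (hu a).2 (by simp [ha]; omega)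
      simp [Fin.le_def, ha] at this ⊢
      omega
    refine le_max_of_le_left ?_
    omega
  · have h := sum_pres n i _ (prod_pres n i L hiL) lam
    have : bnd n (pact n (L.map (st n)).prod lam) i = bnd n lam i := h
    rw [this]; simp

end Helpers

/-- Lemma 6.9: for `i ∈ [n−1]` and `[x^β] κ_{cλ} ≠ 0`,
`max{rightmax_{cλ}(i+1) − leftmin_{cλ}(i), 0} ≥ β_1 + ⋯ + β_i − ((cλ)_1 + ⋯ + (cλ)_i)`. -/
theorem stmt18 (n k : ℕ) (d : Fin (k + 2) → ℕ) (hd : BlockData n k d)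
    (c w0I : Equiv.Perm (Fin n)) (hc : IsStdCox n c)
    (h0 : IsLongest n (Iset n k d) w0I)
    (hlen : len n (w0I * c) = len n w0I + len n c)
    (lam : Fin n → ℕ) (hlam : IsPartition n lam)
    (i : ℕ) (hi1 : 1 ≤ i) (hi2 : i ≤ n - 1)
    (β : Fin n → ℕ) (hβ : coeffOf n β (keyPoly n (pact n c lam)) ≠ 0) :
    psumZ n (fun p => (β p : ℤ)) (i - 1) - psumN n (pact n c lam) (i - 1) ≤
      max ((rightmax n (pact n c lam) ⟨i, by omega⟩ : ℤ) -
        (leftmin n (pact n c lam) ⟨i - 1, by omega⟩ : ℤ)) 0 := by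
  have hn : i < n := by omega
  have hg : Good n lam (keyPoly n (pact n c lam)) := good_key n lam hlam (n * n) c⁻¹
  have hB := cox_bound n c hc lam i hi1 hn
  have hfil : (Finset.univ.filter (fun p : Fin n => p.1 ≤ i - 1)) =
      Finset.univ.filter (fun p : Fin n => p.1 < i) := by
    ext p; simp; omega
  have hS := hg (Finset.univ.filter (fun p : Fin n => p.1 < i))
  rw [card_prefix n i hn.le] at hS
  have hle : ∑ p ∈ Finset.univ.filter (fun p : Fin n => p.1 < i), expOf n β p ≤ bnd n lam i := by
    refine le_trans (Polynomial.le_natDegree_of_ne_zero ?_) hS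
    intro h
    apply hβ
    unfold coeffOf
    rw [← coeff_phi n (Finset.univ.filter (fun p : Fin n => p.1 < i)), h]; simp
  have h1 : psumZ n (fun p => (β p : ℤ)) (i - 1) ≤ (bnd n lam i : ℤ) := by
    unfold psumZ
    rw [hfil]
    have : (∑ p ∈ Finset.univ.filter (fun p : Fin n => p.1 < i), β p) ≤ bnd n lam i := hle
    have h3 := (Nat.cast_le (α := ℤ)).2 this
    rw [Nat.cast_sum] at h3
    exact h3
  have h2 : psumN n (pact n c lam) (i - 1) = (bnd n (pact n c lam) i : ℤ) := by
    unfold psumN bnd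
    rw [hfil]; push_cast; rfl
  rw [h2]
  exact le_trans (by omega) hB

end LSS
end
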